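/- arXiv:1711.04058 — 8 statements merged into one kernel-verified Lean document; each statement's English description precedes it below -/
import Mathlib

section
/- Let ℓ be a natural number with 15 < ℓ < ω, and let h be a 2-coloring of the unordered pairs of elements of the ℓ-cube {0,1}^ℓ (i.e., h : [{0,1}^ℓ]² → {0,1}) with the property that for any three pairwise distinct a, b, c ∈ {0,1}^ℓ, at least one of h(a,b), h(a,c), h(b,c) equals 1 (that is, there is no h-homogeneous triangle in color 0). Then there is a set 𝒜 ⊆ {0,1}^ℓ such that: (1) |𝒜| ≥ 5 and 𝒜 contains a 4-arrangement, and (2) 𝒜 is h-homogeneous in color 1, i.e., h(a,b) = 1 for all distinct a, b ∈ 𝒜. -/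
/-- Strict lexicographic order on `Fin ℓ → Bool` (where `false < true`):
`a <_lex b` iff at the first coordinate where they differ, `a` takes value
`false` and `b` takes value `true`. -/
def lexLt {ℓ : ℕ} (a b : Fin ℓ → Bool) : Prop :=
  ∃ k : Fin ℓ, (∀ j : Fin ℓ, j < k → a j = b j) ∧ a k < b k

/-- `⟨a,b,c,d⟩` is a 4-arrangement in `{0,1}^ℓ`: `a <_lex b <_lex c <_lex d` and
`min{k : a k ≠ c k} = min{k : b k ≠ c k} = min{k : a k ≠ d k} = min{k : b k ≠ d k}`
(expressed by exhibiting the common minimum `k`). -/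
def FourArrangement {ℓ : ℕ} (a b c d : Fin ℓ → Bool) : Prop :=
  lexLt a b ∧ lexLt b c ∧ lexLt c d ∧
  ∃ k : Fin ℓ,
    (∀ j : Fin ℓ, j < k → a j = c j ∧ b j = c j ∧ a j = d j ∧ b j = d j) ∧
    a k ≠ c k ∧ b k ≠ c k ∧ a k ≠ d k ∧ b k ≠ d k

theorem lexLt_or_lexLt_of_ne {ℓ : ℕ} {a b : Fin ℓ → Bool} (hab : a ≠ b) :
    lexLt a b ∨ lexLt b a := by
  rcases lt_or_gt_of_ne (fun hEq => hab (toLex_inj.mp hEq) : toLex a ≠ toLex b) with hlt | hlt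
  · exact Or.inl hlt
  · exact Or.inr hlt

theorem exists_lexLt_of_one_lt_card {ℓ : ℕ} {S : Finset (Fin ℓ → Bool)} (hS : 1 < S.card) :
    ∃ a ∈ S, ∃ b ∈ S, lexLt a b := by
  obtain ⟨a, ha, b, hb, hab⟩ := Finset.one_lt_card.mp hS
  rcases lexLt_or_lexLt_of_ne hab with hlt | hlt
  · exact ⟨a, ha, b, hb, hlt⟩
  · exact ⟨b, hb, a, ha, hlt⟩

/-- A set of at least `n + 2` points of the cube which agree outside the last `n` coordinates
contains a 4-arrangement. -/
theorem exists_fourArrangement_of_agree {ℓ : ℕ} (n : ℕ) (hn : n ≤ ℓ)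
    (S : Finset (Fin ℓ → Bool)) (hcard : n + 2 ≤ S.card)
    (hS : ∀ a ∈ S, ∀ b ∈ S, ∀ j : Fin ℓ, (j : ℕ) + n < ℓ → a j = b j) :
    ∃ a b c d, a ∈ S ∧ b ∈ S ∧ c ∈ S ∧ d ∈ S ∧ FourArrangement a b c d := by
  induction n generalizing S with
  | zero =>
    obtain ⟨a, ha, b, hb, hab⟩ := Finset.one_lt_card.mp (by omega : 1 < S.card)
    exact absurd (funext fun j => hS a ha b hb j j.2) hab
  | succ n ih =>
    let k : Fin ℓ := ⟨ℓ - (n + 1), by omega⟩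
    have agree_half (v : Bool) : ∀ a ∈ S.filter (fun x => x k = v),
        ∀ b ∈ S.filter (fun x => x k = v), ∀ j : Fin ℓ, (j : ℕ) + n < ℓ → a j = b j := by
      intro a ha b hb j hj
      rw [Finset.mem_filter] at ha hb
      by_cases hjk : j = k
      · rw [hjk, ha.2, hb.2]
      · have : (j : ℕ) ≠ ℓ - (n + 1) := fun hEq => hjk (Fin.ext hEq)
        exact hS a ha.1 b hb.1 j (by omega)
    have large_half (v : Bool) (hv : n + 2 ≤ (S.filter (fun x => x k = v)).card) :
        ∃ a b c d, a ∈ S ∧ b ∈ S ∧ c ∈ S ∧ d ∈ S ∧ FourArrangement a b c d := by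
      obtain ⟨a, b, c, d, ha, hb, hc, hd, harr⟩ := ih (by omega) _ hv (agree_half v)
      exact ⟨a, b, c, d, Finset.mem_of_mem_filter _ ha, Finset.mem_of_mem_filter _ hb,
        Finset.mem_of_mem_filter _ hc, Finset.mem_of_mem_filter _ hd, harr⟩
    have hsum : (S.filter (fun x => x k = false)).card +
        (S.filter (fun x => x k = true)).card = S.card := by
      rw [← Finset.card_filter_add_card_filter_not (s := S) (fun x => x k = false)]
      simp
    by_cases h₀ : 1 < (S.filter (fun x => x k = false)).card
    · by_cases h₁ : 1 < (S.filter (fun x => x k = true)).card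
      · obtain ⟨a, ha, b, hb, hab⟩ := exists_lexLt_of_one_lt_card h₀
        obtain ⟨c, hc, d, hd, hcd⟩ := exists_lexLt_of_one_lt_card h₁
        rw [Finset.mem_filter] at ha hb hc hd
        have agree_below {x y : Fin ℓ → Bool} (hx : x ∈ S) (hy : y ∈ S) (j : Fin ℓ)
            (hj : j < k) : x j = y j :=
          hS x hx y hy j (by have : (j : ℕ) < ℓ - (n + 1) := hj; omega)
        refine ⟨a, b, c, d, ha.1, hb.1, hc.1, hd.1, hab,
          ⟨k, agree_below hb.1 hc.1, by simp [hb.2, hc.2]⟩, hcd, k, fun j hj =>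
          ⟨agree_below ha.1 hc.1 j hj, agree_below hb.1 hc.1 j hj,
            agree_below ha.1 hd.1 j hj, agree_below hb.1 hd.1 j hj⟩, ?_⟩
        simp [ha.2, hb.2, hc.2, hd.2]
      · exact large_half false (by omega)
    · exact large_half true (by omega)

theorem exists_fourArrangement_of_card {ℓ : ℕ} (S : Finset (Fin ℓ → Bool))
    (hcard : ℓ + 2 ≤ S.card) :
    ∃ a b c d, a ∈ S ∧ b ∈ S ∧ c ∈ S ∧ d ∈ S ∧ FourArrangement a b c d :=
  exists_fourArrangement_of_agree ℓ le_rfl S hcard fun _ _ _ _ _ hj => by omega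

/-- A greedy Ramsey bound: a symmetric 2-coloring of pairs without triangles of color `0` has, in
every set of size at least `m * k`, a set homogeneous in color `1` of size at least `m` or `k`. -/
theorem exists_homogeneous_of_card {V : Type*} [DecidableEq V] (h : V → V → Fin 2)
    (hsym : ∀ a b, h a b = h b a)
    (htri : ∀ a b c, a ≠ b → a ≠ c → b ≠ c → h a b = 1 ∨ h a c = 1 ∨ h b c = 1)
    (k m : ℕ) (S : Finset V) (hcard : m * k ≤ S.card) :
    ∃ A ⊆ S, (m ≤ A.card ∨ k ≤ A.card) ∧ ∀ a ∈ A, ∀ b ∈ A, a ≠ b → h a b = 1 := by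
  induction m generalizing S with
  | zero => exact ⟨∅, by simp⟩
  | succ m ih =>
    rcases Nat.eq_zero_or_pos k with rfl | hk
    · exact ⟨∅, by simp⟩
    rw [Nat.succ_mul] at hcard
    obtain ⟨v, hv⟩ := Finset.card_pos.mp (by omega : 0 < S.card)
    have hsum := Finset.card_filter_add_card_filter_not (s := S.erase v) (fun x => h v x = 1)
    rw [Finset.card_erase_of_mem hv] at hsum
    by_cases hdeg : k ≤ ((S.erase v).filter (fun x => ¬ h v x = 1)).card
    · refine ⟨_, (Finset.filter_subset _ _).trans (Finset.erase_subset _ _), Or.inr hdeg, ?_⟩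
      intro a ha b hb hab
      simp only [Finset.mem_filter, Finset.mem_erase] at ha hb
      have := htri v a b ha.1.1.symm hb.1.1.symm hab
      tauto
    · obtain ⟨A, hAS, hA, hhom⟩ := ih ((S.erase v).filter (fun x => h v x = 1)) (by omega)
      have hmem : ∀ x ∈ A, (x ≠ v ∧ x ∈ S) ∧ h v x = 1 := fun x hx => by
        simpa only [Finset.mem_filter, Finset.mem_erase] using hAS hx
      have hvA : v ∉ A := fun hvA => (hmem v hvA).1.1 rfl
      refine ⟨insert v A, Finset.insert_subset hv fun x hx => (hmem x hx).1.2, ?_, ?_⟩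
      · rw [Finset.card_insert_of_notMem hvA]
        omega
      · intro a ha b hb hab
        rw [Finset.mem_insert] at ha hb
        rcases ha with rfl | ha <;> rcases hb with rfl | hb
        · exact absurd rfl hab
        · exact (hmem b hb).2
        · rw [hsym]
          exact (hmem a ha).2
        · exact hhom a ha b hb hab

theorem add_two_mul_self_le_two_pow {n : ℕ} (hn : 6 ≤ n) : (n + 2) * (n + 2) ≤ 2 ^ n := by
  induction n, hn using Nat.le_induction with
  | base => norm_num
  | succ n hn ih =>
    rw [pow_succ]
    nlinarith

theorem stmt0 (ℓ : ℕ) (hℓ : 15 < ℓ)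
    (h : (Fin ℓ → Bool) → (Fin ℓ → Bool) → Fin 2)
    (hsym : ∀ a b, h a b = h b a)
    (htri : ∀ a b c : Fin ℓ → Bool, a ≠ b → a ≠ c → b ≠ c →
      h a b = 1 ∨ h a c = 1 ∨ h b c = 1) :
    ∃ 𝒜 : Finset (Fin ℓ → Bool),
      5 ≤ 𝒜.card ∧
      (∃ a b c d, a ∈ 𝒜 ∧ b ∈ 𝒜 ∧ c ∈ 𝒜 ∧ d ∈ 𝒜 ∧ FourArrangement a b c d) ∧
      (∀ a ∈ 𝒜, ∀ b ∈ 𝒜, a ≠ b → h a b = 1) := by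
  obtain ⟨A, -, hA, hhom⟩ := exists_homogeneous_of_card h hsym htri (ℓ + 2) (ℓ + 2) Finset.univ (by
    rw [Finset.card_univ, Fintype.card_fun, Fintype.card_bool, Fintype.card_fin]
    exact add_two_mul_self_le_two_pow (by omega))
  rw [or_self] at hA
  exact ⟨A, by omega, exists_fourArrangement_of_card A hA, hhom⟩
end

section
/- Let 0 < ℓ < ω and let ℬ ⊆ {0,1}^ℓ be a linearly independent set of vectors in the vector space ({0,1}^ℓ, +, ·) over the two-element field GF(2) (addition being coordinatewise addition modulo 2). If a, b, c ∈ {0,1}^ℓ are pairwise distinct and the sumset {a,b,c} + {a,b,c} is contained in ℬ + ℬ, then there are pairwise distinct η, ν, ρ ∈ ℬ such that a + b = η + ν and a + c = η + ρ. -/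
open Pointwise

/-- In a linearly independent set, an element which is a sum of five elements is one of the
summands. -/
theorem LinearIndependent.mem_of_eq_add_five {R V : Type*} [Ring R] [Nontrivial R]
    [AddCommGroup V] [Module R V] {B : Set V} (hB : LinearIndependent R (fun b : B => (b : V)))
    {x q r s t u : V} (hx : x ∈ B) (hq : q ∈ B) (hr : r ∈ B) (hs : s ∈ B) (ht : t ∈ B)
    (hu : u ∈ B) (h : x = q + r + s + t + u) : x = q ∨ x = r ∨ x = s ∨ x = t ∨ x = u := by
  by_contra! hne
  obtain ⟨hxq, hxr, hxs, hxt, hxu⟩ := hne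
  have mem {y : V} (hy : y ∈ B) (hxy : x ≠ y) :
      y ∈ Submodule.span R ((fun b : B => (b : V)) '' {⟨x, hx⟩}ᶜ) :=
    Submodule.subset_span ⟨⟨y, hy⟩, fun e => hxy (congrArg Subtype.val e).symm, rfl⟩
  refine hB.notMem_span_image (s := {⟨x, hx⟩}ᶜ) (x := ⟨x, hx⟩) (by simp) ?_
  change x ∈ _
  have hsum := add_mem (add_mem (add_mem (add_mem (mem hq hxq) (mem hr hxr)) (mem hs hxs))
    (mem ht hxt)) (mem hu hxu)
  rwa [← h] at hsum

theorem stmt1 (ℓ : ℕ) (hℓ : 0 < ℓ) (ℬ : Set (Fin ℓ → ZMod 2))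
    (hB : LinearIndependent (ZMod 2) (fun b : ℬ => (b : Fin ℓ → ZMod 2)))
    (a b c : Fin ℓ → ZMod 2) (hab : a ≠ b) (hac : a ≠ c) (hbc : b ≠ c)
    (hsum : ({a, b, c} : Set (Fin ℓ → ZMod 2)) + {a, b, c} ⊆ ℬ + ℬ) :
    ∃ η ∈ ℬ, ∃ ν ∈ ℬ, ∃ ρ ∈ ℬ, η ≠ ν ∧ η ≠ ρ ∧ ν ≠ ρ ∧
      a + b = η + ν ∧ a + c = η + ρ := by
  have h2 (x : Fin ℓ → ZMod 2) : x + x = 0 := by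
    ext i
    exact CharTwo.add_self_eq_zero (x i)
  have hne {x y p q : Fin ℓ → ZMod 2} (hxy : x ≠ y) (h : x + y = p + q) : p ≠ q := by
    rintro rfl
    exact hxy (by linear_combination h + h2 p - h2 y)
  obtain ⟨p, hp, q, hq, hpq⟩ :=
    Set.mem_add.1 (hsum (Set.add_mem_add (a := a) (b := b) (by simp) (by simp)))
  obtain ⟨r, hr, s, hs, hrs⟩ :=
    Set.mem_add.1 (hsum (Set.add_mem_add (a := a) (b := c) (by simp) (by simp)))
  obtain ⟨t, ht, u, hu, htu⟩ :=
    Set.mem_add.1 (hsum (Set.add_mem_add (a := b) (b := c) (by simp) (by simp)))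
  have npq := hne hab hpq.symm
  have nrs := hne hac hrs.symm
  have meet : p = r ∨ p = s ∨ q = r ∨ q = s := by
    by_contra! hd
    obtain ⟨hpr, hps, hqr, hqs⟩ := hd
    have h0 : p + q + r + s + t + u = 0 := by
      linear_combination hpq + hrs + htu + h2 a + h2 b + h2 c
    have hp' := hB.mem_of_eq_add_five hp hq hr hs ht hu (by linear_combination h2 p - h0)
    have hq' := hB.mem_of_eq_add_five hq hp hr hs ht hu (by linear_combination h2 q - h0)
    have hr' := hB.mem_of_eq_add_five hr hp hq hs ht hu (by linear_combination h2 r - h0)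
    grind
  have close {η ν ρ : Fin ℓ → ZMod 2} (h1 : a + b = η + ν) (h2 : a + c = η + ρ) :
      ν ≠ ρ := by
    rintro rfl
    exact hbc (add_left_cancel (h1.trans h2.symm))
  rcases meet with rfl | rfl | rfl | rfl
  · exact ⟨p, hp, q, hq, s, hs, npq, nrs, close hpq.symm hrs.symm, hpq.symm, hrs.symm⟩
  · rw [add_comm] at hrs
    exact ⟨p, hp, q, hq, r, hr, npq, nrs.symm, close hpq.symm hrs.symm, hpq.symm, hrs.symm⟩
  · rw [add_comm] at hpq
    exact ⟨q, hq, p, hp, s, hs, npq.symm, nrs, close hpq.symm hrs.symm, hpq.symm, hrs.symm⟩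
  · rw [add_comm] at hpq hrs
    exact ⟨q, hq, p, hp, r, hr, npq.symm, nrs.symm, close hpq.symm hrs.symm, hpq.symm, hrs.symm⟩
end

section
/- Let 0 < ℓ < ω and let ℬ ⊆ {0,1}^ℓ be a linearly independent set of vectors in the vector space ({0,1}^ℓ, +, ·) over the two-element field GF(2). If 𝒜 ⊆ {0,1}^ℓ has |𝒜| ≥ 5 and 𝒜 + 𝒜 ⊆ ℬ + ℬ, then there is a unique x ∈ {0,1}^ℓ such that 𝒜 + x ⊆ ℬ (where 𝒜 + x = {a + x : a ∈ 𝒜}). -/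
open Pointwise

section

variable {V : Type*} [AddCommGroup V] [Module (ZMod 2) V] {ℬ 𝒜 : Set V}

open Classical in
/-- A linearly independent set over `ZMod 2` has a dual family of coordinate functionals. -/
lemma LinearIndependent.exists_dual_zmod_two
    (hB : LinearIndependent (ZMod 2) (fun b : ℬ => (b : V))) (a : V) (ha : a ∈ ℬ) :
    ∃ φ : V →ₗ[ZMod 2] ZMod 2, ∀ b ∈ ℬ, φ b = if b = a then 1 else 0 := by
  obtain ⟨g, hg⟩ := LinearMap.exists_leftInverse_of_injective
    (Finsupp.linearCombination (ZMod 2) (fun b : ℬ => (b : V))) (LinearMap.ker_eq_bot.2 hB)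
  refine ⟨Finsupp.lapply ⟨a, ha⟩ ∘ₗ g, fun b hb => ?_⟩
  have h := LinearMap.congr_fun hg (Finsupp.single ⟨b, hb⟩ 1)
  simp only [LinearMap.comp_apply, Finsupp.linearCombination_single, one_smul,
    LinearMap.id_apply] at h
  simp [h, Finsupp.single_apply]

lemma LinearIndependent.pair_eq_of_add_eq
    (hB : LinearIndependent (ZMod 2) (fun b : ℬ => (b : V))) {a b c d : V}
    (ha : a ∈ ℬ) (hb : b ∈ ℬ) (hc : c ∈ ℬ) (hd : d ∈ ℬ) (hab : a ≠ b) (h : a + b = c + d) :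
    (c = a ∧ d = b) ∨ (c = b ∧ d = a) := by
  obtain ⟨φ, hφ⟩ := hB.exists_dual_zmod_two a ha
  have h1 : c = a ∨ d = a := by
    by_contra! hn
    have := congrArg φ h
    simp [hφ _ ha, hφ _ hb, hφ _ hc, hφ _ hd, hab.symm, hn.1, hn.2] at this
  rcases h1 with rfl | rfl
  · exact Or.inl ⟨rfl, (add_left_cancel h).symm⟩
  · rw [add_comm] at h
    exact Or.inr ⟨(add_right_cancel h).symm, rfl⟩

lemma LinearIndependent.eq_or_eq_of_add_add_eq
    (hB : LinearIndependent (ZMod 2) (fun b : ℬ => (b : V))) {a b c d e f : V}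
    (ha : a ∈ ℬ) (hb : b ∈ ℬ) (hc : c ∈ ℬ) (hd : d ∈ ℬ) (he : e ∈ ℬ) (hf : f ∈ ℬ)
    (hab : a ≠ b) (hac : a ≠ c) (had : a ≠ d) (h : a + b + (c + d) = e + f) :
    e = a ∨ f = a := by
  obtain ⟨φ, hφ⟩ := hB.exists_dual_zmod_two a ha
  by_contra! hn
  have := congrArg φ h
  simp [hφ _ ha, hφ _ hb, hφ _ hc, hφ _ hd, hφ _ he, hφ _ hf, hab.symm, hac.symm, had.symm,
    hn.1, hn.2] at this

/-- If the sum of two pairs is again a pair, the two pairs intersect. -/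
lemma LinearIndependent.pairs_intersect
    (hB : LinearIndependent (ZMod 2) (fun b : ℬ => (b : V))) {a b c d e f : V}
    (ha : a ∈ ℬ) (hb : b ∈ ℬ) (hc : c ∈ ℬ) (hd : d ∈ ℬ) (he : e ∈ ℬ) (hf : f ∈ ℬ)
    (hab : a ≠ b) (hcd : c ≠ d) (h : a + b + (c + d) = e + f) :
    a = c ∨ a = d ∨ b = c ∨ b = d := by
  by_contra! hn
  obtain ⟨hac, had, hbc, hbd⟩ := hn
  have h1 := hB.eq_or_eq_of_add_add_eq ha hb hc hd he hf hab hac had h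
  have h2 := hB.eq_or_eq_of_add_add_eq hb ha hc hd he hf hab.symm hbc hbd
    (by rw [← h]; abel)
  have h3 := hB.eq_or_eq_of_add_add_eq hc hd ha hb he hf hcd hac.symm hbc.symm
    (by rw [← h]; abel)
  grind

lemma add_add_add_cancel_zmod_two (u v w : V) : u + w + (v + w) = u + v := by
  rw [add_add_add_comm, ZModModule.add_self, add_zero]

lemma Set.exists_mem_ne_of_five_le_ncard {α : Type*} {s : Set α} (h : 5 ≤ s.ncard)
    (a b c d : α) : ∃ x ∈ s, x ≠ a ∧ x ≠ b ∧ x ≠ c ∧ x ≠ d := by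
  classical
  have hlt : ((({a, b, c, d} : Finset α) : Set α)).ncard < s.ncard := by
    rw [Set.ncard_coe_finset]
    exact Finset.card_le_four.trans_lt h
  obtain ⟨x, hx, hn⟩ := Set.exists_mem_notMem_of_ncard_lt_ncard hlt
  exact ⟨x, hx, by simpa using hn⟩

lemma exists_pair_of_add_subset (hsum : 𝒜 + 𝒜 ⊆ ℬ + ℬ) {a b : V} (ha : a ∈ 𝒜) (hb : b ∈ 𝒜) :
    ∃ p ∈ ℬ, ∃ q ∈ ℬ, a + b = p + q ∧ (a ≠ b → p ≠ q) := by
  obtain ⟨p, hp, q, hq, h⟩ := hsum (Set.add_mem_add ha hb)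
  refine ⟨p, hp, q, hq, h.symm, ?_⟩
  rintro hab rfl
  apply hab
  rw [← sub_eq_zero, ZModModule.sub_eq_add, ← h]
  exact ZModModule.add_self p

/-- Two sums `a + o`, `b + o` with `a`, `b`, `o` in `𝒜` are given by intersecting pairs. -/
lemma LinearIndependent.pairs_intersect_of_add_subset
    (hB : LinearIndependent (ZMod 2) (fun b : ℬ => (b : V)))
    (hsum : 𝒜 + 𝒜 ⊆ ℬ + ℬ) {o a b p q r s : V} (ha : a ∈ 𝒜) (hb : b ∈ 𝒜)
    (hp : p ∈ ℬ) (hq : q ∈ ℬ) (hr : r ∈ ℬ) (hs : s ∈ ℬ) (hpq : p ≠ q) (hrs : r ≠ s)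
    (hapq : a + o = p + q) (hbrs : b + o = r + s) :
    p = r ∨ p = s ∨ q = r ∨ q = s := by
  obtain ⟨e, he, f, hf, h, -⟩ := exists_pair_of_add_subset hsum ha hb
  refine hB.pairs_intersect hp hq hr hs he hf hpq hrs ?_
  rw [← hapq, ← hbrs, add_add_add_cancel_zmod_two, h]

/-- All the pairs contain the common element of two of them. -/
lemma LinearIndependent.mem_pair_of_common
    (hB : LinearIndependent (ZMod 2) (fun b : ℬ => (b : V))) (hcard : 5 ≤ 𝒜.ncard)
    (hsum : 𝒜 + 𝒜 ⊆ ℬ + ℬ) {o a b p q r : V} (ho : o ∈ 𝒜) (ha : a ∈ 𝒜) (hb : b ∈ 𝒜)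
    (hao : a ≠ o) (hbo : b ≠ o) (hab : a ≠ b)
    (hp : p ∈ ℬ) (hq : q ∈ ℬ) (hr : r ∈ ℬ) (hapq : a + o = p + q) (hbpr : b + o = p + r) :
    ∀ c ∈ 𝒜, c + (o + p) ∈ ℬ := by
  have ne_of_sum : ∀ {x u v : V}, x ≠ o → x + o = u + v → u ≠ v := by
    rintro x u v hx h rfl
    rw [ZModModule.add_self, ← ZModModule.sub_eq_add, sub_eq_zero] at h
    exact hx h
  have hpq := ne_of_sum hao hapq
  have hpr := ne_of_sum hbo hbpr
  have inj : ∀ {x y u v : V}, x + o = u + v → y + o = u + v → x = y :=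
    fun h h' => add_right_cancel (h.trans h'.symm)
  have hqr : q ≠ r := by
    rintro rfl
    exact hab (inj hapq hbpr)
  intro c hc
  by_cases hco : c = o
  · rwa [hco, ← add_assoc, ZModModule.add_self, zero_add]
  obtain ⟨s, hs, t, ht, hst, hne⟩ := exists_pair_of_add_subset hsum hc ho
  have hst' := hne hco
  rw [← add_assoc, hst]
  by_cases hsp : s = p
  · rwa [hsp, add_comm, ← add_assoc, ZModModule.add_self, zero_add]
  by_cases htp : t = p
  · rwa [htp, add_assoc, ZModModule.add_self, add_zero]
  exfalso
  have hcqr : c + o = q + r := by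
    have h1 := hB.pairs_intersect_of_add_subset hsum hc ha hs ht hp hq hst' hpq hst hapq
    have h2 := hB.pairs_intersect_of_add_subset hsum hc hb hs ht hp hr hst' hpr hst hbpr
    have : (s = q ∧ t = r) ∨ (s = r ∧ t = q) := by grind
    rcases this with ⟨rfl, rfl⟩ | ⟨rfl, rfl⟩
    · exact hst
    · rw [hst, add_comm]
  obtain ⟨d, hd, hdo, hda, hdb, hdc⟩ := Set.exists_mem_ne_of_five_le_ncard hcard o a b c
  obtain ⟨u, hu, v, hv, huv, hne⟩ := exists_pair_of_add_subset hsum hd ho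
  have huv' := hne hdo
  have h1 := hB.pairs_intersect_of_add_subset hsum hd ha hu hv hp hq huv' hpq huv hapq
  have h2 := hB.pairs_intersect_of_add_subset hsum hd hb hu hv hp hr huv' hpr huv hbpr
  have h3 := hB.pairs_intersect_of_add_subset hsum hd hc hu hv hq hr huv' hqr huv hcqr
  have huv2 : d + o = v + u := by rw [huv, add_comm]
  have : (u = p ∧ v = q) ∨ (u = q ∧ v = p) ∨ (u = p ∧ v = r) ∨ (u = r ∧ v = p) ∨
    (u = q ∧ v = r) ∨ (u = r ∧ v = q) := by grind
  rcases this with ⟨rfl, rfl⟩ | ⟨rfl, rfl⟩ | ⟨rfl, rfl⟩ | ⟨rfl, rfl⟩ | ⟨rfl, rfl⟩ | ⟨rfl, rfl⟩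
  · exact hda (inj huv hapq)
  · exact hda (inj huv2 hapq)
  · exact hdb (inj huv hbpr)
  · exact hdb (inj huv2 hbpr)
  · exact hdc (inj huv hcqr)
  · exact hdc (inj huv2 hcqr)

lemma LinearIndependent.exists_translate_subset
    (hB : LinearIndependent (ZMod 2) (fun b : ℬ => (b : V))) (hcard : 5 ≤ 𝒜.ncard)
    (hsum : 𝒜 + 𝒜 ⊆ ℬ + ℬ) : ∃ x : V, ∀ a ∈ 𝒜, a + x ∈ ℬ := by
  obtain ⟨o, ho, -⟩ := Set.exists_mem_ne_of_five_le_ncard hcard 0 0 0 0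
  obtain ⟨a, ha, hao, -⟩ := Set.exists_mem_ne_of_five_le_ncard hcard o o o o
  obtain ⟨b, hb, hbo, hba, -⟩ := Set.exists_mem_ne_of_five_le_ncard hcard o a a a
  obtain ⟨p, hp, q, hq, hpq, hne⟩ := exists_pair_of_add_subset hsum ha ho
  obtain ⟨r, hr, s, hs, hrs, hne'⟩ := exists_pair_of_add_subset hsum hb ho
  have hqp := hpq.trans (add_comm p q)
  have hsr := hrs.trans (add_comm r s)
  have key := @LinearIndependent.mem_pair_of_common V _ _ ℬ 𝒜 hB hcard hsum o a b
  rcases hB.pairs_intersect_of_add_subset hsum ha hb hp hq hr hs (hne hao) (hne' hbo) hpq hrs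
    with rfl | rfl | rfl | rfl
  · exact ⟨_, key ho ha hb hao hbo hba.symm hp hq hs hpq hrs⟩
  · exact ⟨_, key ho ha hb hao hbo hba.symm hp hq hr hpq hsr⟩
  · exact ⟨_, key ho ha hb hao hbo hba.symm hq hp hs hqp hrs⟩
  · exact ⟨_, key ho ha hb hao hbo hba.symm hq hp hr hqp hsr⟩

lemma LinearIndependent.translate_unique
    (hB : LinearIndependent (ZMod 2) (fun b : ℬ => (b : V))) (hcard : 5 ≤ 𝒜.ncard)
    {x y : V} (hx : ∀ a ∈ 𝒜, a + x ∈ ℬ) (hy : ∀ a ∈ 𝒜, a + y ∈ ℬ) : x = y := by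
  by_contra hxy
  obtain ⟨o, ho, -⟩ := Set.exists_mem_ne_of_five_le_ncard hcard 0 0 0 0
  obtain ⟨a, ha, hao, hao', -⟩ :=
    Set.exists_mem_ne_of_five_le_ncard hcard o (o + y - x) o o
  have hne : o + x ≠ o + y := fun h => hxy (add_left_cancel h)
  have hsum : o + x + (o + y) = a + x + (a + y) := by
    rw [add_add_add_comm, add_add_add_comm a, ZModModule.add_self, ZModModule.add_self]
  rcases hB.pair_eq_of_add_eq (hx o ho) (hy o ho) (hx a ha) (hy a ha) hne hsum
    with ⟨h, -⟩ | ⟨h, -⟩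
  · exact hao (add_right_cancel h)
  · exact hao' (eq_sub_of_add_eq h)

end

theorem stmt2 (ℓ : ℕ) (hℓ : 0 < ℓ) (ℬ 𝒜 : Set (Fin ℓ → ZMod 2))
    (hB : LinearIndependent (ZMod 2) (fun b : ℬ => (b : Fin ℓ → ZMod 2)))
    (hcard : 5 ≤ 𝒜.ncard)
    (hsum : 𝒜 + 𝒜 ⊆ ℬ + ℬ) :
    ∃! x : Fin ℓ → ZMod 2, 𝒜 + ({x} : Set (Fin ℓ → ZMod 2)) ⊆ ℬ := by
  have hiff : ∀ x : Fin ℓ → ZMod 2,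
      𝒜 + ({x} : Set (Fin ℓ → ZMod 2)) ⊆ ℬ ↔ ∀ a ∈ 𝒜, a + x ∈ ℬ := fun x => by
    rw [Set.add_singleton, Set.image_subset_iff]
    rfl
  simp only [hiff]
  obtain ⟨x, hx⟩ := hB.exists_translate_subset hcard hsum
  exact ⟨x, hx, fun y hy => hB.translate_unique hcard hy hx⟩
end

section
/- Suppose P ⊆ 2^ω is a perfect subset of the Cantor space and A_n ⊆ P × P (for n < ω) are analytic (Σ¹₁) sets such that P × P = ⋃_{n<ω} A_n ∪ {(x,x) : x ∈ P}. Then there is a perfect set P* ⊆ P with the following property: for some strictly increasing sequence of integers 0 = n₀ < n₁ < n₂ < n₃ < …, for each k < ω and any distinct x, y ∈ P*: (a) if x↾n_{k+1} ≠ y↾n_{k+1}, then for all x', y' ∈ P*, if x↾n_{k+1} = x'↾n_{k+1} and y↾n_{k+1} = y'↾n_{k+1}, then (x,y) ∈ A_k if and only if (x',y') ∈ A_k; and (b) the set {z↾n_{k+1} : z ∈ P* and z↾n_k = x↾n_k} has exactly two elements. -/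
open MeasureTheory Set Topology Filter

/-- The points at which a set is locally nonmeagre. -/
def nonmeagreKernel {X : Type*} [TopologicalSpace X] (s : Set X) : Set X :=
  {x | ∀ V ∈ 𝓝 x, ¬ IsMeagre (s ∩ V)}

section NonmeagreKernel

variable {X : Type*} [TopologicalSpace X]

theorem isClosed_nonmeagreKernel (s : Set X) : IsClosed (nonmeagreKernel s) := by
  rw [← isOpen_compl_iff, isOpen_iff_mem_nhds]
  intro x hx
  simp only [nonmeagreKernel, mem_compl_iff, mem_ofPred_eq, not_forall, not_not] at hx
  obtain ⟨V, hV, hm⟩ := hx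
  filter_upwards [eventually_mem_nhds_iff.2 hV] with y hy hyk
  exact hyk V hy hm

theorem nonmeagreKernel_subset_closure (s : Set X) : nonmeagreKernel s ⊆ closure s := by
  intro x hx
  rw [mem_closure_iff_nhds]
  intro V hV
  rw [inter_comm]
  exact nonempty_of_not_isMeagre (hx V hV)

theorem disjoint_nonmeagreKernel_of_isMeagre_inter {s V : Set X} (hV : IsOpen V)
    (h : IsMeagre (s ∩ V)) : Disjoint (nonmeagreKernel s) V :=
  disjoint_left.2 fun _ hx hxV => hx V (hV.mem_nhds hxV) h

theorem isMeagre_diff_nonmeagreKernel [SecondCountableTopology X] (s : Set X) :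
    IsMeagre (s \ nonmeagreKernel s) := by
  let b := TopologicalSpace.countableBasis X
  have hb := TopologicalSpace.isBasis_countableBasis X
  refine (isMeagre_biUnion (I := {V ∈ b | IsMeagre (s ∩ V)}) (f := fun V => s ∩ V)
    ((TopologicalSpace.countable_countableBasis X).mono (sep_subset _ _)) fun V hV => hV.2).mono ?_
  rintro x ⟨hxs, hx⟩
  simp only [nonmeagreKernel, mem_ofPred_eq, not_forall, not_not] at hx
  obtain ⟨V, hV, hm⟩ := hx
  obtain ⟨W, hWb, hxW, hWV⟩ := hb.mem_nhds_iff.1 hV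
  exact mem_biUnion (x := W) ⟨hWb, hm.mono (inter_subset_inter_right _ hWV)⟩ ⟨hxs, hxW⟩

theorem isMeagre_nonmeagreKernel_diff_iUnion [SecondCountableTopology X] {ι : Type*} [Countable ι]
    {s : Set X} {t : ι → Set X} (h : s ⊆ ⋃ i, t i) :
    IsMeagre (nonmeagreKernel s \ ⋃ i, nonmeagreKernel (t i)) := by
  set N := nonmeagreKernel s \ ⋃ i, nonmeagreKernel (t i) with hN
  have hNm : BaireMeasurableSet N :=
    (isClosed_nonmeagreKernel s).isOpen_compl.baireMeasurableSet.of_compl.diff <|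
      .iUnion fun i => (isClosed_nonmeagreKernel (t i)).isOpen_compl.baireMeasurableSet.of_compl
  obtain ⟨V, hV, hNV⟩ := hNm.residualEq_isOpen
  have hVN : IsMeagre (V \ N) := by
    filter_upwards [hNV] with x hx hxV
    exact hxV.2 (hx.mpr hxV.1)
  have hNV' : IsMeagre (N \ V) := by
    filter_upwards [hNV] with x hx hxV
    exact hxV.2 (hx.mp hxV.1)
  have hsV : IsMeagre (s ∩ V) := by
    refine ((isMeagre_iUnion fun i => isMeagre_diff_nonmeagreKernel (t i)).union hVN).mono ?_
    rintro x ⟨hxs, hxV⟩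
    obtain ⟨i, hi⟩ := mem_iUnion.1 (h hxs)
    by_cases hxi : x ∈ nonmeagreKernel (t i)
    · exact .inr ⟨hxV, fun hxN => hxN.2 (mem_iUnion.2 ⟨i, hxi⟩)⟩
    · exact .inl (mem_iUnion.2 ⟨i, hi, hxi⟩)
  have hd := disjoint_nonmeagreKernel_of_isMeagre_inter hV hsV
  have hNV_sub : N ⊆ N \ V := fun x hx => ⟨hx, disjoint_left.1 hd hx.1⟩
  exact hNV'.mono hNV_sub

end NonmeagreKernel

theorem exists_cylinder_subset {E : ℕ → Type*} [∀ n, TopologicalSpace (E n)]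
    [∀ n, DiscreteTopology (E n)] {x : ∀ n, E n} {U : Set (∀ n, E n)} (hU : U ∈ 𝓝 x) :
    ∃ n, PiNat.cylinder x n ⊆ U := by
  obtain ⟨V, hVU, hV, hx⟩ := mem_nhds_iff.1 hU
  obtain ⟨n, hn⟩ := PiNat.exists_disjoint_cylinder hV.isClosed_compl (not_not.2 hx)
  exact ⟨n, fun y hy => hVU (not_not.1 fun h => disjoint_left.1 hn h hy)⟩

/-- Analytic sets have the Baire property. -/
theorem MeasureTheory.AnalyticSet.baireMeasurableSet {X : Type*} [TopologicalSpace X] [T2Space X]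
    [SecondCountableTopology X] {s : Set X} (hs : AnalyticSet s) : BaireMeasurableSet s := by
  rw [AnalyticSet] at hs
  obtain rfl | ⟨f, hf, rfl⟩ := hs
  · exact isOpen_empty.baireMeasurableSet
  let F : List ℕ → Set X := fun l => f '' {z | PiNat.res z l.length = l}
  have hF (l) : F l ⊆ ⋃ n : ℕ, F (n :: l) := by
    rintro _ ⟨z, hz, rfl⟩
    refine mem_iUnion.2 ⟨z l.length, z, ?_, rfl⟩
    simpa using hz
  let N := ⋃ l, nonmeagreKernel (F l) \ ⋃ n, nonmeagreKernel (F (n :: l))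
  have hN : IsMeagre N := isMeagre_iUnion fun l => isMeagre_nonmeagreKernel_diff_iUnion (hF l)
  have hF0 : F [] = range f := by simp [F]
  have key : nonmeagreKernel (range f) \ N ⊆ range f := by
    rintro x ⟨hx, hxN⟩
    have step (l) : ∃ n, x ∈ nonmeagreKernel (F l) → x ∈ nonmeagreKernel (F (n :: l)) := by
      by_contra! h
      exact hxN (mem_iUnion.2 ⟨l, (h 0).1, by simpa using fun n => (h n).2⟩)
    choose g hg using step
    let L : ℕ → List ℕ := fun k => k.rec [] fun _ l => g l :: l
    let z : ℕ → ℕ := fun k => g (L k)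
    have hL (k) : L k = PiNat.res z k := by
      induction k with
      | zero => rfl
      | succ k ih => rw [PiNat.res_succ, ← ih]
    have hxL (k) : x ∈ nonmeagreKernel (F (L k)) := by
      induction k with
      | zero => rwa [show L 0 = [] from rfl, hF0]
      | succ k ih => exact hg _ ih
    refine ⟨z, ?_⟩
    by_contra hne
    obtain ⟨U, V, hU, hV, hzU, hxV, hUV⟩ := t2_separation hne
    obtain ⟨k, hk⟩ := exists_cylinder_subset (hf.continuousAt.preimage_mem_nhds (hU.mem_nhds hzU))
    obtain ⟨_, hwV, w, hw, rfl⟩ := mem_closure_iff_nhds.1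
      (nonmeagreKernel_subset_closure _ (hxL k)) V (hV.mem_nhds hxV)
    refine disjoint_left.1 hUV (hk ?_) hwV
    rw [PiNat.cylinder_eq_res]
    simpa [hL] using hw
  refine (isClosed_nonmeagreKernel (range f)).isOpen_compl.baireMeasurableSet.of_compl.congr ?_
  filter_upwards [hN, isMeagre_diff_nonmeagreKernel (range f)] with x hx hx'
  refine propext ⟨fun h => key ⟨h, hx⟩, fun h => ?_⟩
  by_contra h'
  exact hx' ⟨h, h'⟩

section TreeConstruction

theorem isOpenMap_eval_pair {ι X : Type*} [TopologicalSpace X] {i j : ι} (h : i ≠ j) :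
    IsOpenMap fun x : ι → X => (x i, x j) := by
  classical
  refine IsOpenMap.of_sections fun x =>
    ⟨fun p => Function.update (Function.update x i p.1) j p.2, ?_, ?_, ?_⟩
  · fun_prop
  · simp
  · rintro ⟨a, b⟩
    simp [h]

theorem exists_pairwise_mem_of_dense {ι X : Type*} [Finite ι] [TopologicalSpace X]
    {Q : Set (X × X)} (hQ : IsOpen Q) (hQd : Dense Q) {V : ι → Set X} (hV : ∀ i, IsOpen (V i))
    (hVne : ∀ i, (V i).Nonempty) :
    ∃ x : ι → X, (∀ i, x i ∈ V i) ∧ ∀ i j, i ≠ j → (x i, x j) ∈ Q := by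
  have hd : Dense (⋂ p : {p : ι × ι // p.1 ≠ p.2}, {x : ι → X | (x p.1.1, x p.1.2) ∈ Q}) := by
    rw [← sInter_range]
    refine (finite_range _).dense_sInter ?_ ?_ <;> rintro _ ⟨p, rfl⟩
    · exact hQ.preimage (by fun_prop)
    · exact hQd.preimage (isOpenMap_eval_pair p.2)
  obtain ⟨x, hxV, hx⟩ := hd.inter_open_nonempty (univ.pi V)
    (isOpen_set_pi finite_univ fun i _ => hV i) (univ_pi_nonempty_iff.2 hVne)
  exact ⟨x, fun i => hxV i trivial, fun i j hij => mem_iInter.1 hx ⟨(i, j), hij⟩⟩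

variable {P : Set (ℕ → Bool)}

/-- The trace on `P` of the cylinder of points agreeing with `x` below `n`. -/
def relCylinder (x : P) (n : ℕ) : Set P := {y | ∀ i < n, y.1 i = x.1 i}

theorem isOpen_relCylinder (x : P) (n : ℕ) : IsOpen (relCylinder x n) :=
  (PiNat.isOpen_cylinder (fun _ => Bool) x.1 n).preimage continuous_subtype_val

theorem isClosed_relCylinder (x : P) (n : ℕ) : IsClosed (relCylinder x n) := by
  simp only [relCylinder, ofPred_forall]
  exact isClosed_biInter fun i _ =>
    isClosed_eq ((continuous_apply i).comp continuous_subtype_val) continuous_const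

theorem self_mem_relCylinder (x : P) (n : ℕ) : x ∈ relCylinder x n := fun _ _ => rfl

theorem relCylinder_anti (x : P) {m n : ℕ} (h : m ≤ n) : relCylinder x n ⊆ relCylinder x m :=
  fun _ hy i hi => hy i (hi.trans_le h)

theorem mem_relCylinder_comm {x y : P} {n : ℕ} : y ∈ relCylinder x n ↔ x ∈ relCylinder y n :=
  ⟨fun h i hi => (h i hi).symm, fun h i hi => (h i hi).symm⟩

theorem relCylinder_eq {x y : P} {n : ℕ} (h : y ∈ relCylinder x n) :
    relCylinder y n = relCylinder x n :=
  ext fun _ => ⟨fun hz i hi => (hz i hi).trans (h i hi),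
    fun hz i hi => (hz i hi).trans (h i hi).symm⟩

theorem eventually_relCylinder_subset {x : P} {U : Set P} (hU : U ∈ 𝓝 x) :
    ∀ᶠ n in atTop, relCylinder x n ⊆ U := by
  rw [nhds_subtype, mem_comap] at hU
  obtain ⟨V, hV, hVU⟩ := hU
  obtain ⟨n, hn⟩ := exists_cylinder_subset hV
  filter_upwards [eventually_ge_atTop n] with m hm y hy
  exact hVU (hn (relCylinder_anti x hm hy))

theorem eventually_relCylinder_prod_subset {x y : P} {U : Set (P × P)} (hU : U ∈ 𝓝 (x, y)) :
    ∀ᶠ n in atTop, relCylinder x n ×ˢ relCylinder y n ⊆ U := by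
  obtain ⟨V, hV, W, hW, h⟩ := mem_nhds_prod_iff.1 hU
  filter_upwards [eventually_relCylinder_subset hV, eventually_relCylinder_subset hW] with n h1 h2
  exact (prod_mono h1 h2).trans h

/-- `S` consists of points of `P` with distinct restrictions to `n`. -/
def SeparatedAt (n : ℕ) (S : Set P) : Prop :=
  ∀ u ∈ S, ∀ v ∈ S, v ∈ relCylinder u n → u = v

/-- `S'` chooses two points in each cylinder of length `n` around a point of `S`, so that the
rectangles formed from distinct cylinders of length `n'` around points of `S'` lie in `Q` and are
decided by `U`. -/
structure Refines (Q U : Set (P × P)) (n : ℕ) (S : Set P) (n' : ℕ) (S' : Set P) : Prop where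
  lt : n < n'
  exists_mem : ∀ v ∈ S', ∃ u ∈ S, v ∈ relCylinder u n
  ncard_eq : ∀ u ∈ S, (S' ∩ relCylinder u n).ncard = 2
  prod_subset : ∀ u ∈ S', ∀ v ∈ S', u ≠ v → relCylinder u n' ×ˢ relCylinder v n' ⊆ Q
  prod_decided : ∀ u ∈ S', ∀ v ∈ S', u ≠ v →
    relCylinder u n' ×ˢ relCylinder v n' ⊆ U ∨ Disjoint (relCylinder u n' ×ˢ relCylinder v n') U

theorem exists_refines {Q U : Set (P × P)} (hQ : IsOpen Q) (hQd : Dense Q) (hU : IsOpen U)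
    (hQU : Q ⊆ U ∪ interior Uᶜ) (hQdiag : Q ⊆ (diagonal P)ᶜ) {n : ℕ} {S : Set P}
    (hSf : S.Finite) (hS : SeparatedAt n S) :
    ∃ n' S', S'.Finite ∧ SeparatedAt n' S' ∧ Refines Q U n S n' S' := by
  have := hSf.to_subtype
  obtain ⟨x, hxV, hx⟩ := exists_pairwise_mem_of_dense hQ hQd (ι := S × Bool)
    (V := fun i => relCylinder i.1.1 n) (fun i => isOpen_relCylinder _ _)
    fun i => ⟨_, self_mem_relCylinder _ _⟩
  have hinj : Function.Injective x := by
    intro i j hij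
    by_contra hne
    exact hQdiag (hx i j hne) hij
  have hev (i j) (hij : i ≠ j) : ∀ᶠ m in atTop,
      relCylinder (x i) m ×ˢ relCylinder (x j) m ⊆ Q ∧
      (relCylinder (x i) m ×ˢ relCylinder (x j) m ⊆ U ∨
        Disjoint (relCylinder (x i) m ×ˢ relCylinder (x j) m) U) := by
    refine (eventually_relCylinder_prod_subset (hQ.mem_nhds (hx i j hij))).and ?_
    obtain h | h := hQU (hx i j hij)
    · exact (eventually_relCylinder_prod_subset (hU.mem_nhds h)).mono fun _ => .inl
    · refine (eventually_relCylinder_prod_subset (mem_interior_iff_mem_nhds.1 h)).mono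
        fun _ hm => .inr (subset_compl_iff_disjoint_right.1 hm)
  have hall : ∀ᶠ m in atTop, n < m ∧ ∀ i j, i ≠ j →
      relCylinder (x i) m ×ˢ relCylinder (x j) m ⊆ Q ∧
      (relCylinder (x i) m ×ˢ relCylinder (x j) m ⊆ U ∨
        Disjoint (relCylinder (x i) m ×ˢ relCylinder (x j) m) U) := by
    refine (eventually_gt_atTop n).and ?_
    simp only [eventually_all]
    exact hev
  obtain ⟨m, hnm, hm⟩ := hall.exists
  refine ⟨m, range x, finite_range x, ?_, hnm, ?_, ?_, ?_, ?_⟩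
  · rintro _ ⟨i, rfl⟩ _ ⟨j, rfl⟩ h
    by_contra hne
    exact hQdiag ((hm i j (ne_of_apply_ne x hne)).1 ⟨h, self_mem_relCylinder _ _⟩)
      (mem_diagonal _)
  · rintro _ ⟨i, rfl⟩
    exact ⟨i.1, i.1.2, hxV i⟩
  · intro u hu
    have : range x ∩ relCylinder u n = {x (⟨u, hu⟩, false), x (⟨u, hu⟩, true)} := by
      ext v
      constructor
      · rintro ⟨⟨⟨⟨w, hw⟩, b⟩, rfl⟩, hv⟩
        obtain rfl : w = u := by
          refine hS w hw u hu ?_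
          rw [← relCylinder_eq (hxV (⟨w, hw⟩, b))]
          exact mem_relCylinder_comm.1 hv
        cases b <;> simp
      · rintro (rfl | rfl)
        exacts [⟨mem_range_self _, hxV _⟩, ⟨mem_range_self _, hxV _⟩]
    rw [this, ncard_pair (hinj.ne (by simp))]
  · rintro _ ⟨i, rfl⟩ _ ⟨j, rfl⟩ hne
    exact (hm i j (ne_of_apply_ne x hne)).1
  · rintro _ ⟨i, rfl⟩ _ ⟨j, rfl⟩ hne
    exact (hm i j (ne_of_apply_ne x hne)).2

/-- A sequence of finite approximations to a perfect subset of `P`. -/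
theorem exists_refines_seq [Nonempty P] {Q U : ℕ → Set (P × P)} (hQ : ∀ k, IsOpen (Q k))
    (hQd : ∀ k, Dense (Q k)) (hU : ∀ k, IsOpen (U k)) (hQU : ∀ k, Q k ⊆ U k ∪ interior (U k)ᶜ)
    (hQdiag : ∀ k, Q k ⊆ (diagonal P)ᶜ) :
    ∃ (n : ℕ → ℕ) (S : ℕ → Set P), n 0 = 0 ∧ (S 0).Nonempty ∧
      (∀ k, (S k).Finite ∧ SeparatedAt (n k) (S k)) ∧
      ∀ k, Refines (Q k) (U k) (n k) (S k) (n (k + 1)) (S (k + 1)) := by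
  let T := {p : ℕ × Set P // p.2.Finite ∧ SeparatedAt p.1 p.2}
  have step (k : ℕ) (p : T) : ∃ q : T, Refines (Q k) (U k) p.1.1 p.1.2 q.1.1 q.1.2 := by
    obtain ⟨n', S', hf, hs, h⟩ :=
      exists_refines (hQ k) (hQd k) (hU k) (hQU k) (hQdiag k) p.2.1 p.2.2
    exact ⟨⟨(n', S'), hf, hs⟩, h⟩
  choose next hnext using step
  obtain ⟨a⟩ := ‹Nonempty P›
  let root : T := ⟨(0, {a}), finite_singleton a, by
    rintro u rfl v rfl _
    rfl⟩
  let t : ℕ → T := fun k => k.rec root next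
  exact ⟨fun k => (t k).1.1, fun k => (t k).1.2, rfl, ⟨a, rfl⟩, fun k => (t k).2,
    fun k => hnext k (t k)⟩

/-- The set of points of `P` approximated at every stage. -/
def limitSet (n : ℕ → ℕ) (S : ℕ → Set P) : Set P := ⋂ k, ⋃ u ∈ S k, relCylinder u (n k)

theorem isClosed_limitSet {n : ℕ → ℕ} {S : ℕ → Set P} (hS : ∀ k, (S k).Finite) :
    IsClosed (limitSet n S) :=
  isClosed_iInter fun k => (hS k).isClosed_biUnion fun _ _ => isClosed_relCylinder _ _

theorem exists_mem_of_mem_limitSet {n : ℕ → ℕ} {S : ℕ → Set P} {x : P} (hx : x ∈ limitSet n S)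
    (k : ℕ) : ∃ u ∈ S k, x ∈ relCylinder u (n k) := by
  simpa using mem_iInter.1 hx k

variable {n : ℕ → ℕ} {S : ℕ → Set P} {Q U : ℕ → Set (P × P)}

theorem exists_mem_limitSet [CompactSpace P]
    (h : ∀ k, Refines (Q k) (U k) (n k) (S k) (n (k + 1)) (S (k + 1))) {k : ℕ} {u : P}
    (hu : u ∈ S k) : ∃ x ∈ limitSet n S, x ∈ relCylinder u (n k) := by
  have hn : StrictMono n := strictMono_nat_of_lt_succ fun k => (h k).lt
  have child (j) (v : S j) : ∃ w : S (j + 1), w.1 ∈ relCylinder v.1 (n j) := by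
    obtain ⟨w, hw, hwv⟩ := nonempty_of_ncard_ne_zero
      (s := S (j + 1) ∩ relCylinder v.1 (n j)) (by simp [(h j).ncard_eq v v.2])
    exact ⟨⟨w, hw⟩, hwv⟩
  choose c hc using child
  let b : ∀ j, S (k + j) := fun j => j.rec ⟨u, hu⟩ fun j v => c (k + j) v
  have hanti (j) : relCylinder (b (j + 1)).1 (n (k + (j + 1))) ⊆
      relCylinder (b j).1 (n (k + j)) := by
    rw [← relCylinder_eq (hc (k + j) (b j))]
    exact relCylinder_anti _ (hn.monotone (by lia))
  obtain ⟨x, hx⟩ := IsCompact.nonempty_iInter_of_sequence_nonempty_isCompact_isClosed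
    (fun j => relCylinder (b j).1 (n (k + j))) hanti (fun j => ⟨_, self_mem_relCylinder _ _⟩)
    (isClosed_relCylinder _ _).isCompact fun j => isClosed_relCylinder _ _
  rw [mem_iInter] at hx
  have hup (j) (hj : ∃ v ∈ S (j + 1), x ∈ relCylinder v (n (j + 1))) :
      ∃ v ∈ S j, x ∈ relCylinder v (n j) := by
    obtain ⟨v, hv, hxv⟩ := hj
    obtain ⟨w, hw, hvw⟩ := (h j).exists_mem v hv
    refine ⟨w, hw, ?_⟩
    rw [← relCylinder_eq hvw]
    exact relCylinder_anti _ (hn.monotone (by lia)) hxv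
  have hdown (j i) (hj : ∃ v ∈ S (i + j), x ∈ relCylinder v (n (i + j))) :
      ∃ v ∈ S i, x ∈ relCylinder v (n i) := by
    induction j with
    | zero => exact hj
    | succ j ih => exact ih (hup _ hj)
  refine ⟨x, mem_iInter.2 fun j => ?_, hx 0⟩
  have := hdown k j (add_comm k j ▸ ⟨(b j).1, (b j).2, hx j⟩)
  simpa using this

theorem perfect_limitSet [CompactSpace P] (hS : ∀ k, (S k).Finite ∧ SeparatedAt (n k) (S k))
    (h : ∀ k, Refines (Q k) (U k) (n k) (S k) (n (k + 1)) (S (k + 1))) :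
    Perfect (limitSet n S) := by
  have hn : StrictMono n := strictMono_nat_of_lt_succ fun k => (h k).lt
  refine ⟨isClosed_limitSet fun k => (hS k).1, preperfect_iff_nhds.2 fun x hx V hV => ?_⟩
  obtain ⟨k, hk⟩ := (hn.tendsto_atTop.eventually (eventually_relCylinder_subset hV)).exists
  obtain ⟨u, hu, hxu⟩ := exists_mem_of_mem_limitSet hx k
  obtain ⟨v, hv, hxv⟩ := exists_mem_of_mem_limitSet hx (k + 1)
  obtain ⟨w, ⟨hw, hwu⟩, hwv⟩ := exists_ne_of_one_lt_ncard
    (s := S (k + 1) ∩ relCylinder u (n k)) (by simp [(h k).ncard_eq u hu]) v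
  obtain ⟨y, hy, hyw⟩ := exists_mem_limitSet h hw
  refine ⟨y, ⟨hk ?_, hy⟩, ?_⟩
  · rw [relCylinder_eq hxu, ← relCylinder_eq hwu]
    exact relCylinder_anti _ (hn.monotone (by lia)) hyw
  · rintro rfl
    refine hwv ((hS (k + 1)).2 w hw v hv ?_)
    rw [← relCylinder_eq hyw]
    exact mem_relCylinder_comm.1 hxv

theorem ncard_restrict_limitSet [CompactSpace P]
    (hS : ∀ k, (S k).Finite ∧ SeparatedAt (n k) (S k))
    (h : ∀ k, Refines (Q k) (U k) (n k) (S k) (n (k + 1)) (S (k + 1))) {x : P}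
    (hx : x ∈ limitSet n S) (k : ℕ) :
    ((fun (z : P) (i : Fin (n (k + 1))) => z.1 i) '' (limitSet n S ∩ relCylinder x (n k))).ncard
      = 2 := by
  obtain ⟨u, hu, hxu⟩ := exists_mem_of_mem_limitSet hx k
  have restrict_eq {y z : P} : (fun i : Fin (n (k + 1)) => y.1 i) =
      (fun i : Fin (n (k + 1)) => z.1 i) ↔ y ∈ relCylinder z (n (k + 1)) := by
    simp [funext_iff, relCylinder, Fin.forall_iff]
  have : (fun (z : P) (i : Fin (n (k + 1))) => z.1 i) '' (limitSet n S ∩ relCylinder x (n k)) =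
      (fun (z : P) (i : Fin (n (k + 1))) => z.1 i) '' (S (k + 1) ∩ relCylinder u (n k)) := by
    rw [relCylinder_eq hxu]
    ext r
    constructor
    · rintro ⟨z, ⟨hz, hzu⟩, rfl⟩
      obtain ⟨v, hv, hzv⟩ := exists_mem_of_mem_limitSet hz (k + 1)
      refine ⟨v, ⟨hv, ?_⟩, restrict_eq.2 (mem_relCylinder_comm.1 hzv)⟩
      rw [← relCylinder_eq hzu]
      exact relCylinder_anti _ (h k).lt.le (mem_relCylinder_comm.1 hzv)
    · rintro ⟨v, ⟨hv, hvu⟩, rfl⟩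
      obtain ⟨z, hz, hzv⟩ := exists_mem_limitSet h hv
      refine ⟨z, ⟨hz, ?_⟩, restrict_eq.2 hzv⟩
      rw [← relCylinder_eq hvu]
      exact relCylinder_anti _ (h k).lt.le hzv
  rw [this, InjOn.ncard_image, (h k).ncard_eq u hu]
  exact fun v hv w hw hvw => (hS (k + 1)).2 v hv.1 w hw.1
    (mem_relCylinder_comm.1 (restrict_eq.1 hvw))

theorem mem_of_mem_limitSet {O : ℕ → Set (P × P)} (hO : Antitone O) (hQO : ∀ k, Q k ⊆ O k)
    (h : ∀ k, Refines (Q k) (U k) (n k) (S k) (n (k + 1)) (S (k + 1))) {x y : P}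
    (hx : x ∈ limitSet n S) (hy : y ∈ limitSet n S) (hxy : x ≠ y) (k : ℕ) : (x, y) ∈ O k := by
  have hn : StrictMono n := strictMono_nat_of_lt_succ fun k => (h k).lt
  obtain ⟨m, hm, hkm⟩ := (((tendsto_add_atTop_nat 1).eventually <| hn.tendsto_atTop.eventually <|
    eventually_relCylinder_subset (compl_singleton_mem_nhds hxy)).and
      (eventually_ge_atTop k)).exists
  obtain ⟨u, hu, hxu⟩ := exists_mem_of_mem_limitSet hx (m + 1)
  obtain ⟨v, hv, hyv⟩ := exists_mem_of_mem_limitSet hy (m + 1)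
  refine hO hkm (hQO m <| (h m).prod_subset u hu v hv ?_ ⟨hxu, hyv⟩)
  rintro rfl
  rw [← relCylinder_eq hxu] at hyv
  exact hm hyv rfl

theorem mem_iff_of_mem_limitSet
    (h : ∀ k, Refines (Q k) (U k) (n k) (S k) (n (k + 1)) (S (k + 1))) {x y x' y' : P} {k : ℕ}
    (hx : x ∈ limitSet n S) (hy : y ∈ limitSet n S) (hxy : x ∉ relCylinder y (n (k + 1)))
    (hx' : x' ∈ relCylinder x (n (k + 1))) (hy' : y' ∈ relCylinder y (n (k + 1))) :
    (x, y) ∈ U k ↔ (x', y') ∈ U k := by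
  obtain ⟨u, hu, hxu⟩ := exists_mem_of_mem_limitSet hx (k + 1)
  obtain ⟨v, hv, hyv⟩ := exists_mem_of_mem_limitSet hy (k + 1)
  rw [relCylinder_eq hyv] at hxy hy'
  rw [relCylinder_eq hxu] at hx'
  have huv : u ≠ v := by
    rintro rfl
    exact hxy hxu
  obtain hd | hd := (h k).prod_decided u hu v hv huv
  · exact iff_of_true (hd ⟨hxu, hyv⟩) (hd ⟨hx', hy'⟩)
  · exact iff_of_false (disjoint_left.1 hd ⟨hxu, hyv⟩) (disjoint_left.1 hd ⟨hx', hy'⟩)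

end TreeConstruction

/-- Countably many Baire measurable sets in a Baire space agree with open sets on the intersection
of a decreasing sequence of dense open sets. -/
theorem exists_antitone_dense_open_forall_mem_iff {X : Type*} [TopologicalSpace X] [BaireSpace X]
    {B : ℕ → Set X} (hB : ∀ k, BaireMeasurableSet (B k)) :
    ∃ U O : ℕ → Set X, (∀ k, IsOpen (U k)) ∧ (∀ k, IsOpen (O k)) ∧ (∀ k, Dense (O k)) ∧
      Antitone O ∧ ∀ x, (∀ k, x ∈ O k) → ∀ k, x ∈ B k ↔ x ∈ U k := by
  choose U hU hBU using fun k => (hB k).residualEq_isOpen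
  have hres : {x | ∀ k, x ∈ B k ↔ x ∈ U k} ∈ residual X :=
    eventually_countable_forall.2 fun k => (hBU k).mono fun x hx => iff_of_eq hx
  obtain ⟨t, ht, htG, htd⟩ := mem_residual.1 hres
  obtain ⟨f, hf, rfl⟩ := htG.eq_iInter_nat
  refine ⟨U, fun k => ⋂ j ∈ Iic k, f j, hU, fun k => (finite_Iic k).isOpen_biInter fun j _ => hf j,
    fun k => htd.mono fun x hx => mem_iInter₂.2 fun j _ => mem_iInter.1 hx j,
    fun k l hkl => biInter_subset_biInter_left (Iic_subset_Iic.2 hkl),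
    fun x hx => ht (mem_iInter.2 fun k => mem_iInter₂.1 (hx k) k self_mem_Iic)⟩

theorem dense_union_interior_compl {X : Type*} [TopologicalSpace X] (U : Set X) :
    Dense (U ∪ interior Uᶜ) := by
  rw [interior_compl]
  intro x
  by_cases hx : x ∈ closure U
  · exact closure_mono subset_union_left hx
  · exact subset_closure (.inr hx)

theorem dense_compl_diagonal (X : Type*) [TopologicalSpace X] [PerfectSpace X] :
    Dense (diagonal X)ᶜ := by
  rintro ⟨x, y⟩
  by_cases hxy : x = y
  · subst hxy
    rw [mem_closure_iff_nhds]
    intro W hW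
    obtain ⟨V, hV, V', hV', h⟩ := mem_nhds_prod_iff.1 hW
    obtain ⟨y, hyV, hy⟩ := Filter.nonempty_of_mem (inter_mem (mem_nhdsWithin_of_mem_nhds hV')
      (self_mem_nhdsWithin (a := x) (s := {x}ᶜ)))
    exact ⟨(x, y), h ⟨mem_of_mem_nhds hV, hyV⟩, fun h => hy (Eq.symm h)⟩
  · exact subset_closure hxy

theorem Preperfect.perfectSpace {X : Type*} [TopologicalSpace X] {C : Set X} (hC : Preperfect C) :
    PerfectSpace C := by
  refine ⟨preperfect_iff_nhds.2 fun x _ U hU => ?_⟩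
  rw [nhds_subtype, mem_comap] at hU
  obtain ⟨V, hV, hVU⟩ := hU
  obtain ⟨y, ⟨hyV, hyC⟩, hyx⟩ := preperfect_iff_nhds.1 hC x x.2 V hV
  exact ⟨⟨y, hyC⟩, ⟨hVU hyV, trivial⟩, fun h => hyx (congrArg Subtype.val h)⟩

theorem Perfect.image_subtype_val {X : Type*} [TopologicalSpace X] {C : Set X} (hC : IsClosed C)
    {s : Set C} (hs : Perfect s) : Perfect (Subtype.val '' s) := by
  refine ⟨hC.isClosedEmbedding_subtypeVal.isClosedMap _ hs.closed, preperfect_iff_nhds.2 ?_⟩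
  rintro _ ⟨x, hx, rfl⟩ U hU
  obtain ⟨y, ⟨hyU, hys⟩, hyx⟩ := preperfect_iff_nhds.1 hs.acc x hx _
    (continuous_subtype_val.continuousAt.preimage_mem_nhds hU)
  exact ⟨y, ⟨hyU, mem_image_of_mem _ hys⟩, Subtype.val_injective.ne hyx⟩

theorem stmt3 (P : Set (ℕ → Bool)) (hP : Perfect P) (hPne : P.Nonempty)
    (A : ℕ → Set ((ℕ → Bool) × (ℕ → Bool)))
    (hAsub : ∀ n, A n ⊆ P ×ˢ P)
    (hAan : ∀ n, AnalyticSet (A n))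
    (hcover : P ×ˢ P = (⋃ n, A n) ∪ ((fun x => (x, x)) '' P)) :
    ∃ Pstar : Set (ℕ → Bool), Pstar ⊆ P ∧ Perfect Pstar ∧ Pstar.Nonempty ∧
      ∃ nseq : ℕ → ℕ, nseq 0 = 0 ∧ StrictMono nseq ∧
        ∀ k : ℕ, ∀ x ∈ Pstar, ∀ y ∈ Pstar, x ≠ y →
          ((¬ (∀ i < nseq (k + 1), x i = y i)) →
            ∀ x' ∈ Pstar, ∀ y' ∈ Pstar,
              (∀ i < nseq (k + 1), x i = x' i) →
              (∀ i < nseq (k + 1), y i = y' i) →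
              ((x, y) ∈ A k ↔ (x', y') ∈ A k)) ∧
          ((fun (z : ℕ → Bool) (i : Fin (nseq (k + 1))) => z (i : ℕ)) ''
              {z | z ∈ Pstar ∧ ∀ i < nseq k, z i = x i}).ncard = 2 := by
  have : CompactSpace P := isCompact_iff_compactSpace.1 hP.closed.isCompact
  have : PolishSpace Bool := inferInstance
  have : PolishSpace P := hP.closed.polishSpace
  have : PerfectSpace P := hP.acc.perfectSpace
  have : Nonempty P := hPne.to_subtype
  have hB (k) : BaireMeasurableSet
      ((fun p : P × P => ((p.1 : ℕ → Bool), (p.2 : ℕ → Bool))) ⁻¹' A k) :=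
    ((hAan k).preimage (by fun_prop)).baireMeasurableSet
  obtain ⟨U, O, hU, hO, hOd, hOanti, hAU⟩ := exists_antitone_dense_open_forall_mem_iff hB
  have hdiag : IsOpen (diagonal P)ᶜ := isClosed_diagonal.isOpen_compl
  have hUo (k) : IsOpen (U k ∪ interior (U k)ᶜ) := (hU k).union isOpen_interior
  obtain ⟨n, S, hn0, hS0, hS, h⟩ := exists_refines_seq
    (Q := fun k => O k ∩ (U k ∪ interior (U k)ᶜ) ∩ (diagonal P)ᶜ) (U := U)
    (fun k => ((hO k).inter (hUo k)).inter hdiag)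
    (fun k => ((hOd k).inter_of_isOpen_left (dense_union_interior_compl _)
      (hO k)).inter_of_isOpen_right (dense_compl_diagonal P) hdiag)
    hU (fun k p hp => hp.1.2) (fun k p hp => hp.2)
  have hmem {x y : P} (hx : x ∈ limitSet n S) (hy : y ∈ limitSet n S) (hxy : x ≠ y) (k : ℕ) :
      (x.1, y.1) ∈ A k ↔ (x, y) ∈ U k :=
    hAU (x, y) (mem_of_mem_limitSet hOanti (fun k p hp => hp.1.1) h hx hy hxy) k
  refine ⟨Subtype.val '' limitSet n S, by simp, (perfect_limitSet hS h).image_subtype_val hP.closed,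
    ?_, n, hn0, strictMono_nat_of_lt_succ fun k => (h k).lt, ?_⟩
  · obtain ⟨u, hu⟩ := hS0
    obtain ⟨x, hx, -⟩ := exists_mem_limitSet h hu
    exact ⟨x, mem_image_of_mem _ hx⟩
  rintro k _ ⟨x, hx, rfl⟩ _ ⟨y, hy, rfl⟩ hxy
  refine ⟨?_, ?_⟩
  · rintro hne _ ⟨x', hx', rfl⟩ _ ⟨y', hy', rfl⟩ hxx' hyy'
    have hne' : x' ≠ y' := by
      rintro rfl
      exact hne fun i hi => (hxx' i hi).trans (hyy' i hi).symm
    rw [hmem hx hy (fun e => hxy (congrArg _ e)), hmem hx' hy' hne']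
    exact mem_iff_of_mem_limitSet h hx hy hne (fun i hi => (hxx' i hi).symm)
      fun i hi => (hyy' i hi).symm
  · rw [← ncard_restrict_limitSet hS h hx k]
    congr 1
    ext r
    constructor
    · rintro ⟨_, ⟨⟨z, hz, rfl⟩, hzx⟩, rfl⟩
      exact ⟨z, ⟨hz, hzx⟩, rfl⟩
    · rintro ⟨z, ⟨hz, hzx⟩, rfl⟩
      exact ⟨z, ⟨⟨z, hz, rfl⟩, hzx⟩, rfl⟩
end

section
/- Let B ⊆ 2^ω and let x, y ∈ 2^ω be distinct. If the intersection (B + x) ∩ (B + y) is finite, then its cardinality is even. (The point is that if x + b₀ = y + b₁ with b₀, b₁ ∈ B, then also x + b₁ = y + b₀, so the map z ↦ z + x + y is a fixed-point-free involution of (B + x) ∩ (B + y).) -/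
/-- Coordinatewise addition modulo 2 on the Cantor space `ℕ → Bool`. -/
def cadd (x y : ℕ → Bool) : ℕ → Bool := fun n => xor (x n) (y n)

theorem Finset.even_card_of_involution {α : Type*} (s : Finset α) (g : α → α)
    (hne : ∀ a ∈ s, g a ≠ a) (hmem : ∀ a ∈ s, g a ∈ s) (hinv : ∀ a ∈ s, g (g a) = a) :
    Even s.card := by
  have h : ∑ _a ∈ s, (1 : ZMod 2) = 0 :=
    Finset.sum_involution (fun a _ => g a) (fun _ _ => by decide)
      (fun a ha _ => hne a ha) hmem hinv
  rw [← ZMod.natCast_eq_zero_iff_even]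
  simpa using h

theorem cadd_cadd_cadd_swap (b x y : ℕ → Bool) : cadd (cadd b x) (cadd x y) = cadd b y := by
  funext n
  simp [cadd]

theorem cadd_comm (x y : ℕ → Bool) : cadd x y = cadd y x := by
  funext n
  simp [cadd, Bool.xor_comm]

theorem cadd_cadd_cancel_right (z w : ℕ → Bool) : cadd (cadd z w) w = z := by
  funext n
  simp [cadd]

theorem cadd_cadd_ne_self {x y : ℕ → Bool} (hxy : x ≠ y) (z : ℕ → Bool) :
    cadd z (cadd x y) ≠ z := by
  intro h
  apply hxy
  funext n
  have hn : xor (z n) (xor (x n) (y n)) = z n := congrFun h n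
  revert hn
  cases x n <;> cases y n <;> cases z n <;> simp

theorem stmt5 (B : Set (ℕ → Bool)) (x y : ℕ → Bool) (hxy : x ≠ y)
    (hfin : (((cadd · x) '' B) ∩ ((cadd · y) '' B)).Finite) :
    Even (((cadd · x) '' B) ∩ ((cadd · y) '' B)).ncard := by
  rw [Set.ncard_eq_toFinset_card _ hfin]
  refine Finset.even_card_of_involution _ (cadd · (cadd x y))
    (fun z _ => cadd_cadd_ne_self hxy z) (fun z hz => ?_)
    (fun z _ => cadd_cadd_cancel_right z _)
  rw [Set.Finite.mem_toFinset] at hz ⊢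
  obtain ⟨⟨b, hb, hbz⟩, ⟨c, hc, hcz⟩⟩ := hz
  refine ⟨⟨c, hc, ?_⟩, ⟨b, hb, ?_⟩⟩
  · rw [← hcz, cadd_comm x y]
    exact (cadd_cadd_cadd_swap c y x).symm
  · rw [← hbz]
    exact (cadd_cadd_cadd_swap b x y).symm
end

section
/- Let 0 < n < ω, let u be a finite set, let ⟨η_α : α ∈ u⟩ be elements of {0,1}^n and let ⟨ρ_{α,β} : α, β ∈ u, α ≠ β⟩ be elements of {0,1}^n with ρ_{α,β} = ρ_{β,α}, such that the combined family ⟨η_α : α ∈ u⟩⌢⟨ρ_{α,β} : α < β in u⟩ is linearly independent over GF(2). Let S = {η_α : α ∈ u} ∪ {η_α + ρ_{α,β} : α, β ∈ u, α ≠ β}. If b₀, c₀, b₁, c₁ ∈ S are pairwise distinct and satisfy b₀ + c₀ = b₁ + c₁, then for some distinct α, β ∈ u we have {b₀, c₀, b₁, c₁} = {η_α, η_β, η_α + ρ_{α,β}, η_β + ρ_{α,β}}. Moreover, for some i < 2, {b_i, c_i} = {η_α, η_β} or {b_i, c_i} = {η_α + ρ_{α,β}, η_β} or {b_i, c_i}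 = {η_α + ρ_{α,β}, η_α}. -/
/-- The unordered pairs `{a, b}` and `{c, d}` coincide. -/
def SameEdge {ι : Type*} (a b c d : ι) : Prop := a = c ∧ b = d ∨ a = d ∧ b = c

theorem sameEdge_self {ι : Type*} (a b : ι) : SameEdge a b a b := Or.inl ⟨rfl, rfl⟩

theorem sameEdge_comm_right {ι : Type*} {a b c d : ι} : SameEdge a b c d ↔ SameEdge a b d c :=
  or_comm

/-- Four distinct pairs `(a, x), (a, y), (b, z), (b, w)`, where a pair `(c, d)` stands for the edge
`{c, d}` if `c ≠ d` and for no edge otherwise, and in which every edge is repeated: the only edge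
is `{a, b}`, carried once at `a` and once at `b`. -/
theorem eq_of_edges_cancel {ι : Type*} {a b x y z w : ι}
    (hxy : x ≠ y) (hzw : z ≠ w) (hab : a = b → x ≠ z ∧ x ≠ w ∧ y ≠ z ∧ y ≠ w)
    (hx : a ≠ x → SameEdge a y a x ∨ SameEdge b z a x ∨ SameEdge b w a x)
    (hy : a ≠ y → SameEdge a x a y ∨ SameEdge b z a y ∨ SameEdge b w a y)
    (hz : b ≠ z → SameEdge a x b z ∨ SameEdge a y b z ∨ SameEdge b w b z)
    (hw : b ≠ w → SameEdge a x b w ∨ SameEdge a y b w ∨ SameEdge b z b w) :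
    a ≠ b ∧ (x = a ∧ y = b ∨ x = b ∧ y = a) ∧ (z = a ∧ w = b ∨ z = b ∧ w = a) := by
  simp only [SameEdge] at hx hy hz hw
  have hx' : x = a ∨ a ≠ b ∧ x = b := by
    clear hy hz hw
    grind
  have hy' : y = a ∨ a ≠ b ∧ y = b := by
    clear hx hz hw
    grind
  have hz' : z = b ∨ a ≠ b ∧ z = a := by
    clear hx hy hw
    grind
  have hw' : w = b ∨ a ≠ b ∧ w = a := by
    clear hx hy hz
    grind
  clear hx hy hz hw
  grind

theorem indicator_add_eq {p q s t : Prop} [Decidable p] [Decidable q] [Decidable s] [Decidable t]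
    (h : (if p then 1 else 0 : ZMod 2) + (if q then 1 else 0) =
      (if s then 1 else 0) + (if t then 1 else 0)) :
    (p → q ∨ s ∨ t) ∧ (q → p ∨ s ∨ t) ∧ (s → p ∨ q ∨ t) ∧ (t → p ∨ q ∨ s) ∧
      (p → q → (s ↔ t)) ∧ (p → s → (q ↔ t)) ∧ (p → t → (q ↔ s)) := by
  by_cases p <;> by_cases q <;> by_cases s <;> by_cases t <;> simp_all

theorem exists_dual_of_linearIndependent {K V I : Type*} [Field K] [AddCommGroup V] [Module K V]
    {v : I → V} (hv : LinearIndependent K v) :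
    ∃ f : V →ₗ[K] (I →₀ K), ∀ i, f (v i) = Finsupp.single i 1 := by
  obtain ⟨f, hf⟩ := (Finsupp.linearCombination K v).exists_leftInverse_of_injective
    (LinearMap.ker_eq_bot.2 hv)
  refine ⟨f, fun i => ?_⟩
  simpa using LinearMap.congr_fun hf (Finsupp.single i 1)

open Classical in
/-- Coordinate functionals for a linearly independent family of vertex vectors `η a` and edge
vectors `ρ a b`, evaluated at the vectors `η a` and `η a + ρ a b`. -/
theorem exists_coordinates {ι K V : Type*} [LinearOrder ι] [Field K] [AddCommGroup V] [Module K V]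
    {u : Finset ι} {η : ι → V} {ρ : ι → ι → V} (hρsym : ∀ a b : ι, ρ a b = ρ b a)
    (hind : LinearIndependent K
      (Sum.elim (fun a : {a : ι // a ∈ u} => η a)
        (fun q : {q : ι × ι // q.1 ∈ u ∧ q.2 ∈ u ∧ q.1 < q.2} => ρ q.1.1 q.1.2))) :
    (∀ c ∈ u, ∃ g : V →ₗ[K] K, ∀ a ∈ u, ∀ b ∈ u,
      g (η a + if a = b then 0 else ρ a b) = if a = c then 1 else 0) ∧
    (∀ c ∈ u, ∀ d ∈ u, c ≠ d → ∃ g : V →ₗ[K] K, ∀ a ∈ u, ∀ b ∈ u,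
      g (η a + if a = b then 0 else ρ a b) = if SameEdge a b c d then 1 else 0) := by
  obtain ⟨f, hf⟩ := exists_dual_of_linearIndependent hind
  have hfη : ∀ a (ha : a ∈ u), f (η a) = Finsupp.single (Sum.inl ⟨a, ha⟩) 1 :=
    fun a ha => hf (Sum.inl ⟨a, ha⟩)
  have hfρ : ∀ a b (ha : a ∈ u) (hb : b ∈ u) (h : a < b),
      f (ρ a b) = Finsupp.single (Sum.inr ⟨(a, b), ha, hb, h⟩) 1 :=
    fun a b ha hb h => hf (Sum.inr ⟨(a, b), ha, hb, h⟩)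
  have hlt : ∀ c ∈ u, ∀ d ∈ u, c < d → ∃ g : V →ₗ[K] K, ∀ a ∈ u, ∀ b ∈ u,
      g (η a + if a = b then 0 else ρ a b) = if SameEdge a b c d then 1 else 0 := by
    intro c hc d hd hcd
    refine ⟨Finsupp.lapply (Sum.inr ⟨(c, d), hc, hd, hcd⟩) ∘ₗ f, fun a ha b hb => ?_⟩
    rcases lt_trichotomy a b with h | h | h
    · have : ¬ (a = d ∧ b = c) := by rintro ⟨rfl, rfl⟩; exact lt_asymm h hcd
      simp [SameEdge, h.ne, hfη a ha, hfρ a b ha hb h, Finsupp.single_apply, this]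
    · have : ¬ SameEdge a b c d := by
        subst h; rintro (⟨rfl, rfl⟩ | ⟨rfl, rfl⟩) <;> exact lt_irrefl _ hcd
      rw [if_neg this]
      simp [h, hfη, hb]
    · have : ¬ (a = c ∧ b = d) := by rintro ⟨rfl, rfl⟩; exact lt_asymm h hcd
      simp [SameEdge, h.ne', hfη a ha, hρsym a b, hfρ b a hb ha h, Finsupp.single_apply, this,
        and_comm]
  refine ⟨fun c hc => ⟨Finsupp.lapply (Sum.inl ⟨c, hc⟩) ∘ₗ f, fun a ha b hb => ?_⟩,
    fun c hc d hd hcd => ?_⟩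
  · rcases lt_trichotomy a b with h | h | h
    · simp [h.ne, hfη a ha, hfρ a b ha hb h, Finsupp.single_apply]
    · simp [h, hfη, hb, Finsupp.single_apply]
    · simp [h.ne', hfη a ha, hρsym a b, hfρ b a hb ha h, Finsupp.single_apply]
  · rcases hcd.lt_or_gt with h | h
    · exact hlt c hc d hd h
    · simpa only [sameEdge_comm_right (c := c)] using hlt d hd c hc h

/-- If four points split into two pairs filled by `P, P'` and by `Q, Q'`, then one of `{b₀, c₀}`,
`{b₁, c₁}` is `{P, Q}`, `{P', Q}` or `{P', P}`. -/
theorem pair_eq_of_split {V : Type*} {b₀ c₀ b₁ c₁ P Q P' Q' : V}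
    (h : (b₀ = P ∧ c₀ = P' ∨ b₀ = P' ∧ c₀ = P) ∧ (b₁ = Q ∧ c₁ = Q' ∨ b₁ = Q' ∧ c₁ = Q) ∨
      (b₀ = P ∧ b₁ = P' ∨ b₀ = P' ∧ b₁ = P) ∧ (c₀ = Q ∧ c₁ = Q' ∨ c₀ = Q' ∧ c₁ = Q) ∨
      (b₀ = P ∧ c₁ = P' ∨ b₀ = P' ∧ c₁ = P) ∧ (c₀ = Q ∧ b₁ = Q' ∨ c₀ = Q' ∧ b₁ = Q)) :
    ({b₀, c₀, b₁, c₁} : Set V) = {P, Q, P', Q'} ∧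
      (({b₀, c₀} : Set V) = {P, Q} ∨ ({b₀, c₀} : Set V) = {P', Q} ∨ ({b₀, c₀} : Set V) = {P', P} ∨
       ({b₁, c₁} : Set V) = {P, Q} ∨ ({b₁, c₁} : Set V) = {P', Q} ∨
       ({b₁, c₁} : Set V) = {P', P}) := by
  rcases h with ⟨⟨rfl, rfl⟩ | ⟨rfl, rfl⟩, ⟨rfl, rfl⟩ | ⟨rfl, rfl⟩⟩ |
      ⟨⟨rfl, rfl⟩ | ⟨rfl, rfl⟩, ⟨rfl, rfl⟩ | ⟨rfl, rfl⟩⟩ |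
      ⟨⟨rfl, rfl⟩ | ⟨rfl, rfl⟩, ⟨rfl, rfl⟩ | ⟨rfl, rfl⟩⟩ <;>
    refine ⟨?_, by simp [Set.pair_eq_pair_iff]⟩ <;>
    · ext v
      grind


theorem stmt6 {ι : Type*} [LinearOrder ι] (n : ℕ) (hn : 0 < n)
    (u : Finset ι)
    (η : ι → (Fin n → ZMod 2)) (ρ : ι → ι → (Fin n → ZMod 2))
    (hρsym : ∀ a b : ι, ρ a b = ρ b a)
    (hind : LinearIndependent (ZMod 2)
      (Sum.elim (fun a : {a : ι // a ∈ u} => η a)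
        (fun q : {q : ι × ι // q.1 ∈ u ∧ q.2 ∈ u ∧ q.1 < q.2} => ρ q.1.1 q.1.2)))
    (S : Set (Fin n → ZMod 2))
    (hS : S = {v | ∃ a ∈ u, v = η a} ∪
      {v | ∃ a ∈ u, ∃ b ∈ u, a ≠ b ∧ v = η a + ρ a b})
    (b₀ c₀ b₁ c₁ : Fin n → ZMod 2)
    (hb₀ : b₀ ∈ S) (hc₀ : c₀ ∈ S) (hb₁ : b₁ ∈ S) (hc₁ : c₁ ∈ S)
    (hdist : [b₀, c₀, b₁, c₁].Pairwise (· ≠ ·))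
    (heq : b₀ + c₀ = b₁ + c₁) :
    ∃ a ∈ u, ∃ b ∈ u, a ≠ b ∧
      ({b₀, c₀, b₁, c₁} : Set (Fin n → ZMod 2)) =
        {η a, η b, η a + ρ a b, η b + ρ a b} ∧
      (({b₀, c₀} : Set (Fin n → ZMod 2)) = {η a, η b} ∨
       ({b₀, c₀} : Set (Fin n → ZMod 2)) = {η a + ρ a b, η b} ∨
       ({b₀, c₀} : Set (Fin n → ZMod 2)) = {η a + ρ a b, η a} ∨
       ({b₁, c₁} : Set (Fin n → ZMod 2)) = {η a, η b} ∨
       ({b₁, c₁} : Set (Fin n → ZMod 2)) = {η a + ρ a b, η b} ∨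
       ({b₁, c₁} : Set (Fin n → ZMod 2)) = {η a + ρ a b, η a}) := by
  classical
  obtain ⟨hvertex, hedge⟩ := exists_coordinates hρsym hind
  set r : ι → ι → (Fin n → ZMod 2) := fun a b => if a = b then 0 else ρ a b with hr
  have hr0 : ∀ a, r a a = 0 := fun a => by simp [hr]
  have hr1 : ∀ a b, a ≠ b → r a b = ρ a b := fun a b h => by simp [hr, h]
  replace hvertex : ∀ c ∈ u, ∃ g : (Fin n → ZMod 2) →ₗ[ZMod 2] ZMod 2, ∀ a ∈ u, ∀ b ∈ u,
      g (η a + r a b) = if a = c then 1 else 0 := hvertex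
  replace hedge : ∀ c ∈ u, ∀ d ∈ u, c ≠ d → ∃ g : (Fin n → ZMod 2) →ₗ[ZMod 2] ZMod 2,
      ∀ a ∈ u, ∀ b ∈ u, g (η a + r a b) = if SameEdge a b c d then 1 else 0 := hedge
  clear_value r
  have hmem : ∀ v ∈ S, ∃ a ∈ u, ∃ b ∈ u, v = η a + r a b := by
    intro v hv
    rw [hS] at hv
    rcases hv with ⟨a, ha, rfl⟩ | ⟨a, ha, b, hb, hab, rfl⟩
    · exact ⟨a, ha, a, ha, by rw [hr0, add_zero]⟩
    · exact ⟨a, ha, b, hb, by rw [hr1 a b hab]⟩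
  obtain ⟨a₀, ha₀, x₀, hx₀, rfl⟩ := hmem _ hb₀
  obtain ⟨a₁, ha₁, x₁, hx₁, rfl⟩ := hmem _ hc₀
  obtain ⟨a₂, ha₂, x₂, hx₂, rfl⟩ := hmem _ hb₁
  obtain ⟨a₃, ha₃, x₃, hx₃, rfl⟩ := hmem _ hc₁
  have hA : ∀ c ∈ u, (if a₀ = c then 1 else 0 : ZMod 2) + (if a₁ = c then 1 else 0) =
      (if a₂ = c then 1 else 0) + (if a₃ = c then 1 else 0) := by
    intro c hc
    obtain ⟨g, hg⟩ := hvertex c hc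
    rw [← hg a₀ ha₀ x₀ hx₀, ← hg a₁ ha₁ x₁ hx₁, ← hg a₂ ha₂ x₂ hx₂, ← hg a₃ ha₃ x₃ hx₃,
      ← map_add, heq, map_add]
  have hR : ∀ c ∈ u, ∀ d ∈ u, c ≠ d →
      (if SameEdge a₀ x₀ c d then 1 else 0 : ZMod 2) + (if SameEdge a₁ x₁ c d then 1 else 0) =
      (if SameEdge a₂ x₂ c d then 1 else 0) + (if SameEdge a₃ x₃ c d then 1 else 0) := by
    intro c hc d hd hcd
    obtain ⟨g, hg⟩ := hedge c hc d hd hcd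
    rw [← hg a₀ ha₀ x₀ hx₀, ← hg a₁ ha₁ x₁ hx₁, ← hg a₂ ha₂ x₂ hx₂, ← hg a₃ ha₃ x₃ hx₃,
      ← map_add, heq, map_add]
  have hR₀ := fun h => (indicator_add_eq (hR a₀ ha₀ x₀ hx₀ h)).1 (sameEdge_self _ _)
  have hR₁ := fun h => (indicator_add_eq (hR a₁ ha₁ x₁ hx₁ h)).2.1 (sameEdge_self _ _)
  have hR₂ := fun h => (indicator_add_eq (hR a₂ ha₂ x₂ hx₂ h)).2.2.1 (sameEdge_self _ _)
  have hR₃ := fun h => (indicator_add_eq (hR a₃ ha₃ x₃ hx₃ h)).2.2.2.1 (sameEdge_self _ _)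
  have hne : ∀ {a b x y}, η a + r a x ≠ η b + r b y → a = b → x ≠ y := by
    rintro a b x y h rfl rfl
    exact h rfl
  simp only [List.pairwise_cons, List.mem_cons, List.not_mem_nil, or_false, forall_eq_or_imp,
    forall_eq] at hdist
  obtain ⟨⟨h01, h02, h03⟩, ⟨h12, h13⟩, h23, -⟩ := hdist
  replace h01 := hne h01
  replace h02 := hne h02
  replace h03 := hne h03
  replace h12 := hne h12
  replace h13 := hne h13
  replace h23 := hne h23
  have hpair : (a₀ = a₁ ∧ a₂ = a₃) ∨ (a₀ = a₂ ∧ a₁ = a₃) ∨ (a₀ = a₃ ∧ a₁ = a₂) := by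
    obtain ⟨h0, -, -, -, h1, h2, h3⟩ := indicator_add_eq (hA a₀ ha₀)
    have h4 := (indicator_add_eq (hA a₁ ha₁)).2.1 rfl
    have h5 := (indicator_add_eq (hA a₂ ha₂)).2.2.1 rfl
    clear * - h0 h1 h2 h3 h4 h5
    grind
  have hval : ∀ {a b x y}, a ≠ b → (x = a ∧ y = b ∨ x = b ∧ y = a) →
      (η a + r a x = η a ∧ η a + r a y = η a + ρ a b) ∨
      (η a + r a x = η a + ρ a b ∧ η a + r a y = η a) := by
    rintro a b x y hab (⟨rfl, rfl⟩ | ⟨rfl, rfl⟩)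
    · exact Or.inl ⟨by rw [hr0, add_zero], by rw [hr1 _ _ hab]⟩
    · exact Or.inr ⟨by rw [hr1 _ _ hab], by rw [hr0, add_zero]⟩
  have hval' : ∀ {a b x y}, a ≠ b → (x = a ∧ y = b ∨ x = b ∧ y = a) →
      (η b + r b x = η b ∧ η b + r b y = η b + ρ a b) ∨
      (η b + r b x = η b + ρ a b ∧ η b + r b y = η b) := by
    intro a b x y hab h
    rw [hρsym a b]
    exact hval hab.symm h.symm
  rcases hpair with ⟨rfl, rfl⟩ | ⟨rfl, rfl⟩ | ⟨rfl, rfl⟩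
  · obtain ⟨hab, hx, hz⟩ := eq_of_edges_cancel (h01 rfl) (h23 rfl)
      (fun h => ⟨h02 h, h03 h, h12 h, h13 h⟩) hR₀ hR₁ hR₂ hR₃
    exact ⟨a₀, ha₀, a₂, ha₂, hab, pair_eq_of_split (Or.inl ⟨hval hab hx, hval' hab hz⟩)⟩
  · obtain ⟨hab, hx, hz⟩ := eq_of_edges_cancel (h02 rfl) (h13 rfl)
      (fun h => ⟨h01 h, h03 h, (h12 h.symm).symm, h23 h⟩)
      (fun h => or_left_comm.1 (hR₀ h)) hR₂ hR₁ (fun h => (hR₃ h).imp_right or_comm.1)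
    exact ⟨a₀, ha₀, a₁, ha₁, hab,
      pair_eq_of_split (Or.inr (Or.inl ⟨hval hab hx, hval' hab hz⟩))⟩
  · obtain ⟨hab, hx, hz⟩ := eq_of_edges_cancel (h03 rfl) (h12 rfl)
      (fun h => ⟨h01 h, h02 h, (h13 h.symm).symm, (h23 h.symm).symm⟩)
      (fun h => or_rotate.2 (hR₀ h)) hR₃ (fun h => (hR₁ h).imp_right or_comm.1)
      (fun h => (or_congr_right or_comm).1 (hR₂ h))
    exact ⟨a₀, ha₀, a₁, ha₁, hab,
      pair_eq_of_split (Or.inr (Or.inr ⟨hval hab hx, hval' hab hz⟩))⟩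
end

section
/- Let 0 < n < ω, let u be a finite set, let ⟨η_α : α ∈ u⟩ be elements of {0,1}^n and let ⟨ρ_{α,β} : α, β ∈ u, α ≠ β⟩ be elements of {0,1}^n with ρ_{α,β} = ρ_{β,α}, such that the combined family ⟨η_α : α ∈ u⟩⌢⟨ρ_{α,β} : α < β in u⟩ is linearly independent over GF(2). Suppose v₁, v₂, v₃ ∈ {0,1}^n are such that each v_i is either of the form ρ_{α,β} for some distinct α, β ∈ u, or of the form η_α + η_β + ρ_{α,β} for some distinct α, β ∈ u. Then v₁ + v₂ + v₃ ≠ 0. (Consequently, there are no three vectors σ_i, σ_j, σ_k whose three pairwise sums all have one of these two forms.) -/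
theorem LinearIndependent.exists_linearMap_apply_eq {K V W ι : Type*} [DivisionRing K]
    [AddCommGroup V] [Module K V] [AddCommGroup W] [Module K W] {v : ι → V}
    (hv : LinearIndependent K v) (w : ι → W) : ∃ f : V →ₗ[K] W, ∀ i, f (v i) = w i := by
  obtain ⟨f, hf⟩ := (((Module.Basis.span hv).constr ℕ) w).exists_extend
  refine ⟨f, fun i => ?_⟩
  have h := LinearMap.congr_fun hf (Module.Basis.span hv i)
  rwa [Module.Basis.constr_basis, LinearMap.comp_apply, Submodule.subtype_apply,
    Module.Basis.span_apply] at h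


theorem stmt7 {ι : Type*} [LinearOrder ι] (n : ℕ) (hn : 0 < n)
    (u : Finset ι)
    (η : ι → (Fin n → ZMod 2)) (ρ : ι → ι → (Fin n → ZMod 2))
    (hρsym : ∀ a b : ι, ρ a b = ρ b a)
    (hind : LinearIndependent (ZMod 2)
      (Sum.elim (fun a : {a : ι // a ∈ u} => η a)
        (fun q : {q : ι × ι // q.1 ∈ u ∧ q.2 ∈ u ∧ q.1 < q.2} => ρ q.1.1 q.1.2)))
    (v₁ v₂ v₃ : Fin n → ZMod 2)
    (h₁ : (∃ a ∈ u, ∃ b ∈ u, a ≠ b ∧ v₁ = ρ a b) ∨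
          (∃ a ∈ u, ∃ b ∈ u, a ≠ b ∧ v₁ = η a + η b + ρ a b))
    (h₂ : (∃ a ∈ u, ∃ b ∈ u, a ≠ b ∧ v₂ = ρ a b) ∨
          (∃ a ∈ u, ∃ b ∈ u, a ≠ b ∧ v₂ = η a + η b + ρ a b))
    (h₃ : (∃ a ∈ u, ∃ b ∈ u, a ≠ b ∧ v₃ = ρ a b) ∨
          (∃ a ∈ u, ∃ b ∈ u, a ≠ b ∧ v₃ = η a + η b + ρ a b)) :
    v₁ + v₂ + v₃ ≠ 0 := by
  obtain ⟨f, hf⟩ := hind.exists_linearMap_apply_eq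
    (Sum.elim (fun _ => (0 : ZMod 2)) (fun _ => 1))
  have hη : ∀ a ∈ u, f (η a) = 0 := fun a ha => hf (Sum.inl ⟨a, ha⟩)
  have hρ : ∀ a ∈ u, ∀ b ∈ u, a ≠ b → f (ρ a b) = 1 := by
    intro a ha b hb hab
    rcases lt_or_gt_of_ne hab with h | h
    · exact hf (Sum.inr ⟨(a, b), ha, hb, h⟩)
    · rw [hρsym]
      exact hf (Sum.inr ⟨(b, a), hb, ha, h⟩)
  have hval : ∀ v : Fin n → ZMod 2, ((∃ a ∈ u, ∃ b ∈ u, a ≠ b ∧ v = ρ a b) ∨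
      (∃ a ∈ u, ∃ b ∈ u, a ≠ b ∧ v = η a + η b + ρ a b)) → f v = 1 := by
    rintro v (⟨a, ha, b, hb, hab, rfl⟩ | ⟨a, ha, b, hb, hab, rfl⟩)
    · exact hρ a ha b hb hab
    · simp [hη a ha, hη b hb, hρ a ha b hb hab]
  intro h
  have h' := congrArg f h
  rw [map_add, map_add, map_zero, hval v₁ h₁, hval v₂ h₂, hval v₃ h₃] at h'
  exact absurd h' (by decide)
end

section
/- Let ℙ be the forcing notion whose conditions and order are defined in the context. Then for every N, M < ω and every δ < ω₁, the set Z^{N,M}_δ = {p ∈ ℙ : n^p ≥ N and m_*^p ≥ M and δ ∈ u^p} is open dense in ℙ (i.e., every condition has an extension in Z^{N,M}_δ, and every extension of a member of Z^{N,M}_δ is in Z^{N,M}_δ). -/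
/-- The set of countable ordinals, i.e. ω₁ viewed as a type. -/
abbrev Omega1 : Type 1 := {o : Ordinal.{0} // o < (Cardinal.aleph 1).ord}

/-- Coordinatewise addition modulo 2 of two 0-1 sequences (of the same length). -/
def addL (σ τ : List Bool) : List Bool := List.zipWith xor σ τ

/-- Interpret a finite 0-1 sequence as a vector over GF(2) (inside `ℕ → ZMod 2`). -/
def toVec (σ : List Bool) : ℕ → ZMod 2 :=
  fun i => if h : i < σ.length then (if σ.get ⟨i, h⟩ then 1 else 0) else 0

/-- A condition of the forcing notion ℙ. -/
structure Cond where
  /-- `u` : a nonempty finite subset of ω₁ -/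
  u : Finset Omega1
  /-- the length `n` -/
  n : ℕ
  /-- the number `m_*` of trees -/
  mstar : ℕ
  /-- `η̄ = ⟨η_α : α ∈ u⟩ ⊆ ^n2` -/
  η : Omega1 → List Bool
  /-- `t̄ = ⟨t_m : m < m_*⟩` -/
  t : ℕ → Set (List Bool)
  /-- the first component `ρ_{α,β}` of `μ(α,β)` -/
  ρ : Omega1 → Omega1 → List Bool
  /-- the second component `ℓ_{α,β}` of `μ(α,β)` -/
  ℓ : Omega1 → Omega1 → ℕ
  /-- `K : u → m_*` -/
  K : Omega1 → ℕ
  hu : u.Nonempty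
  hn : 0 < n
  hm : 0 < mstar
  hη : ∀ a ∈ u, (η a).length = n
  /-- each `t_m ⊆ ^{n≥}2` is a tree with all maximal nodes of length `n` -/
  htree : ∀ m < mstar, (∀ σ ∈ t m, σ.length ≤ n) ∧
    (∀ σ ∈ t m, ∀ τ, τ <+: σ → τ ∈ t m) ∧
    (∀ σ ∈ t m, σ.length < n → ∃ τ ∈ t m, σ <+: τ ∧ σ ≠ τ)
  hρlen : ∀ a ∈ u, ∀ b ∈ u, a ≠ b → (ρ a b).length = n
  hρsym : ∀ a b, ρ a b = ρ b a
  hℓsym : ∀ a b, ℓ a b = ℓ b a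
  hℓlt : ∀ a ∈ u, ∀ b ∈ u, a ≠ b → ℓ a b < mstar
  /-- (4): `η_α + ρ_{α,β}, η_β + ρ_{α,β} ∈ t_{ℓ_{α,β}}` -/
  h4 : ∀ a ∈ u, ∀ b ∈ u, a ≠ b →
    addL (η a) (ρ a b) ∈ t (ℓ a b) ∧ addL (η b) (ρ a b) ∈ t (ℓ a b)
  /-- (5): `K_α < m_*` and `η_α ∈ t_{K_α}` -/
  h5 : ∀ a ∈ u, K a < mstar ∧ η a ∈ t (K a)
  /-- (6): for `α < β < γ` in `u`, `{K_α, K_γ, ℓ_{α,γ}} ≠ {K_β, K_γ, ℓ_{β,γ}}` -/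
  h6 : ∀ a ∈ u, ∀ b ∈ u, ∀ c ∈ u, a < b → b < c →
    ({K a, K c, ℓ a c} : Set ℕ) ≠ ({K b, K c, ℓ b c} : Set ℕ)
  /-- (7): for `m < m' < m_*`, `t_m ∩ t_{m'} ∩ ^n2 = ∅` -/
  h7 : ∀ m m', m < m' → m' < mstar →
    ∀ σ, σ.length = n → σ ∈ t m → σ ∉ t m'
  /-- (8): `t_m ∩ ^n2 ⊆ {η_α + ρ_{α,β}} ∪ {η_α}` -/
  h8 : ∀ m < mstar, ∀ σ ∈ t m, σ.length = n →
    (∃ a ∈ u, σ = η a) ∨ (∃ a ∈ u, ∃ b ∈ u, a ≠ b ∧ σ = addL (η a) (ρ a b))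
  /-- (9): `⟨η_α : α ∈ u⟩⌢⟨ρ_{α,β} : α < β in u⟩` is linearly independent over GF(2) -/
  h9 : LinearIndependent (ZMod 2)
    (Sum.elim (fun a : {a : Omega1 // a ∈ u} => toVec (η a))
      (fun q : {q : Omega1 × Omega1 // q.1 ∈ u ∧ q.2 ∈ u ∧ q.1 < q.2} =>
        toVec (ρ q.1.1 q.1.2)))

/-- The order of ℙ (`p ≤ q` : `q` is a stronger condition than `p`). -/
def Cond.Le (p q : Cond) : Prop :=
  p.u ⊆ q.u ∧ p.n ≤ q.n ∧ p.mstar ≤ q.mstar ∧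
  (∀ a ∈ p.u, (q.η a).take p.n = p.η a) ∧
  (∀ m < p.mstar, ∀ σ : List Bool, σ.length = p.n → (σ ∈ q.t m ↔ σ ∈ p.t m)) ∧
  (∀ a ∈ p.u, q.K a = p.K a) ∧
  (∀ a ∈ p.u, ∀ b ∈ p.u, a ≠ b → q.ℓ a b = p.ℓ a b ∧ p.ρ a b <+: q.ρ a b)

/-- The sequence of length `L` whose only nonzero entry is at position `i`. -/
def unitSeq (L i : ℕ) : List Bool := List.ofFn fun j : Fin L => decide (j.1 = i)

@[simp] lemma length_unitSeq (L i : ℕ) : (unitSeq L i).length = L := by simp [unitSeq]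

lemma getElem?_unitSeq {L i j : ℕ} (hj : j < L) :
    (unitSeq L i)[j]? = some (decide (j = i)) := by
  simp [unitSeq, hj]

lemma addL_append {σ σ' : List Bool} (h : σ.length = σ'.length) (τ τ' : List Bool) :
    addL (σ ++ τ) (σ' ++ τ') = addL σ σ' ++ addL τ τ' :=
  List.zipWith_append h

@[simp] lemma length_addL (σ τ : List Bool) :
    (addL σ τ).length = min σ.length τ.length := by simp [addL]

lemma toVec_append_unitSeq {L j : ℕ} (σ : List Bool) (i : ℕ) (hj : j < L) :
    toVec (σ ++ unitSeq L i) (σ.length + j) = if j = i then 1 else 0 := by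
  simp [toVec, unitSeq, hj]

namespace Cond

open Classical in
/-- The sequence `η_a`, replaced by the zero sequence for `a ∉ u`. -/
noncomputable def baseη (p : Cond) (a : Omega1) : List Bool :=
  if a ∈ p.u then p.η a else List.replicate p.n false

open Classical in
/-- The sequence `ρ_{a,b}`, replaced by the zero sequence if `{a, b}` is not a pair from `u`. -/
noncomputable def baseρ (p : Cond) (a b : Omega1) : List Bool :=
  if a ∈ p.u ∧ b ∈ p.u ∧ a ≠ b then p.ρ a b else List.replicate p.n false

/-- The sequence `η_a`, prolonged by a unit sequence chosen according to `g`. -/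
noncomputable def extη (p : Cond) (g : Sym2 Omega1 → ℕ) (L : ℕ) (a : Omega1) : List Bool :=
  p.baseη a ++ unitSeq L (g s(a, a))

/-- The sequence `ρ_{a,b}`, prolonged by a unit sequence chosen according to `g`. -/
noncomputable def extρ (p : Cond) (g : Sym2 Omega1 → ℕ) (L : ℕ) (a b : Omega1) : List Bool :=
  p.baseρ a b ++ unitSeq L (g s(a, b))

open Classical in
/-- The function `K`, extended by fresh values chosen according to `g`. -/
noncomputable def extK (p : Cond) (g : Sym2 Omega1 → ℕ) (a : Omega1) : ℕ :=
  if a ∈ p.u then p.K a else p.mstar + g s(a, a)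

open Classical in
/-- The function `ℓ`, extended by fresh values chosen according to `g`. -/
noncomputable def extℓ (p : Cond) (g : Sym2 Omega1 → ℕ) (a b : Omega1) : ℕ :=
  if a ∈ p.u ∧ b ∈ p.u then p.ℓ a b else p.mstar + g s(a, b)

open Classical in
/-- The maximal nodes of the extended trees: `η_a` for `a = b`, and `η_a + ρ_{a,b}` otherwise. -/
noncomputable def extNode (p : Cond) (g : Sym2 Omega1 → ℕ) (L : ℕ) (a b : Omega1) : List Bool :=
  if a = b then p.extη g L a else addL (p.extη g L a) (p.extρ g L a b)

open Classical in
/-- The index of the extended tree containing the node `extNode a b`. -/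
noncomputable def extIndex (p : Cond) (g : Sym2 Omega1 → ℕ) (a b : Omega1) : ℕ :=
  if a = b then p.extK g a else p.extℓ g a b

/-- The extended trees, generated by their maximal nodes. -/
def extTree (p : Cond) (u : Finset Omega1) (g : Sym2 Omega1 → ℕ) (L m : ℕ) : Set (List Bool) :=
  {σ | ∃ a ∈ u, ∃ b ∈ u, p.extIndex g a b = m ∧ σ <+: p.extNode g L a b}

variable (p : Cond) {u : Finset Omega1} {g : Sym2 Omega1 → ℕ} {L : ℕ}

@[simp] lemma length_baseη (a : Omega1) : (p.baseη a).length = p.n := by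
  unfold baseη; split_ifs with h
  · exact p.hη a h
  · simp

@[simp] lemma length_baseρ (a b : Omega1) : (p.baseρ a b).length = p.n := by
  unfold baseρ; split_ifs with h
  · exact p.hρlen a h.1 b h.2.1 h.2.2
  · simp

@[simp] lemma length_extη (a : Omega1) : (p.extη g L a).length = p.n + L := by simp [extη]

@[simp] lemma length_extρ (a b : Omega1) : (p.extρ g L a b).length = p.n + L := by simp [extρ]

@[simp] lemma length_extNode (a b : Omega1) : (p.extNode g L a b).length = p.n + L := by
  unfold extNode; split_ifs <;> simp

lemma extρ_comm (a b : Omega1) : p.extρ g L a b = p.extρ g L b a := by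
  simp only [extρ, baseρ, p.hρsym a b, Sym2.eq_swap (a := a) (b := b)]
  grind

lemma extℓ_comm (a b : Omega1) : p.extℓ g a b = p.extℓ g b a := by
  simp only [extℓ, p.hℓsym a b, Sym2.eq_swap (a := a) (b := b), and_comm]

lemma extK_lt (hgL : ∀ a ∈ u, ∀ b ∈ u, g s(a, b) < L) {a : Omega1} (ha : a ∈ u) :
    p.extK g a < p.mstar + L := by
  unfold extK; split_ifs with h
  · have := (p.h5 a h).1
    omega
  · have := hgL a ha a ha
    omega

lemma extℓ_lt (hgL : ∀ a ∈ u, ∀ b ∈ u, g s(a, b) < L) {a b : Omega1} (ha : a ∈ u) (hb : b ∈ u)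
    (hab : a ≠ b) : p.extℓ g a b < p.mstar + L := by
  unfold extℓ; split_ifs with h
  · have := p.hℓlt a h.1 b h.2 hab
    omega
  · have := hgL a ha b hb
    omega

lemma getElem?_extNode (hg : Set.InjOn g u.sym2) {a b : Omega1} (ha : a ∈ u) (hb : b ∈ u)
    {j : ℕ} (hj : j < L) :
    (p.extNode g L a b)[p.n + j]? = some (decide (j = g s(a, a) ∨ j = g s(a, b))) := by
  by_cases hab : a = b
  · subst hab
    simp [extNode, extη, getElem?_unitSeq hj, List.getElem?_append_right]
  · have hne : g s(a, a) ≠ g s(a, b) := fun h => by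
      have := hg (by simpa using ha) (by simp [ha, hb]) h
      simp_all
    have hlen : (addL (p.baseη a) (p.baseρ a b)).length = p.n := by simp
    rw [extNode, if_neg hab, extη, extρ, addL_append (by simp),
      List.getElem?_append_right (by simp), hlen, Nat.add_sub_cancel_left, addL,
      List.getElem?_zipWith, getElem?_unitSeq hj, getElem?_unitSeq hj]
    by_cases h1 : j = g s(a, a)
    · simp [h1, hne]
    · simp [h1]

lemma extNode_injective (hg : Set.InjOn g u.sym2) (hgL : ∀ a ∈ u, ∀ b ∈ u, g s(a, b) < L)
    {a b c d : Omega1} (ha : a ∈ u) (hb : b ∈ u) (hc : c ∈ u) (hd : d ∈ u)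
    (h : p.extNode g L a b = p.extNode g L c d) : a = c ∧ b = d := by
  have key : ∀ x ∈ u, ∀ y ∈ u,
      (s(x, y) = s(a, a) ∨ s(x, y) = s(a, b)) ↔ (s(x, y) = s(c, c) ∨ s(x, y) = s(c, d)) := by
    intro x hx y hy
    have e := congrArg (fun l : List Bool => l[p.n + g s(x, y)]?) h
    simp only [getElem?_extNode p hg ha hb (hgL x hx y hy),
      getElem?_extNode p hg hc hd (hgL x hx y hy), Option.some.injEq, decide_eq_decide] at e
    have inj : ∀ v ∈ u, ∀ w ∈ u, (g s(x, y) = g s(v, w) ↔ s(x, y) = s(v, w)) := fun v hv w hw =>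
      hg.eq_iff (by simp [hx, hy]) (by simp [hv, hw])
    rwa [inj a ha a ha, inj a ha b hb, inj c hc c hc, inj c hc d hd] at e
  have h1 := key a ha a ha
  have h2 := key a ha b hb
  have h3 := key c hc d hd
  simp only [Sym2.eq_iff] at h1 h2 h3
  grind

lemma mem_ext_of_length_eq {m : ℕ} {σ : List Bool} (hσ : σ.length = p.n + L)
    (h : σ ∈ p.extTree u g L m) :
    ∃ a ∈ u, ∃ b ∈ u, p.extIndex g a b = m ∧ σ = p.extNode g L a b := by
  obtain ⟨a, ha, b, hb, hm, hp⟩ := h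
  exact ⟨a, ha, b, hb, hm, hp.eq_of_length (by simp [hσ])⟩

lemma ext_triples_ne (hg : Set.InjOn g u.sym2) {a b c : Omega1} (ha : a ∈ u)
    (hb : b ∈ u) (hc : c ∈ u) (hab : a < b) (hbc : b < c) :
    ({p.extK g a, p.extK g c, p.extℓ g a c} : Set ℕ) ≠
      {p.extK g b, p.extK g c, p.extℓ g b c} := by
  have hac := hab.trans hbc
  by_cases hall : a ∈ p.u ∧ b ∈ p.u ∧ c ∈ p.u
  · obtain ⟨ha', hb', hc'⟩ := hall
    simpa [extK, extℓ, ha', hb', hc'] using p.h6 a ha' b hb' c hc' hab hbc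
  have inj : ∀ v ∈ u, ∀ w ∈ u, ∀ x ∈ u, ∀ y ∈ u, g s(v, w) = g s(x, y) →
      v = x ∧ w = y ∨ v = y ∧ w = x := fun v hv w hw x hx y hy h =>
    Sym2.eq_iff.1 (hg (by simp [hv, hw]) (by simp [hx, hy]) h)
  have hKlt : ∀ x ∈ p.u, p.K x < p.mstar := fun x hx => (p.h5 x hx).1
  have hKa : p.extK g a ∈ ({p.extK g a, p.extK g c, p.extℓ g a c} : Set ℕ) := by simp
  have hℓa : p.extℓ g a c ∈ ({p.extK g a, p.extK g c, p.extℓ g a c} : Set ℕ) := by simp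
  have hKb : p.extK g b ∈ ({p.extK g b, p.extK g c, p.extℓ g b c} : Set ℕ) := by simp
  have hℓac : a ∈ p.u → c ∈ p.u → p.ℓ a c < p.mstar := fun h h' => p.hℓlt a h c h' hac.ne
  have hℓbc : b ∈ p.u → c ∈ p.u → p.ℓ b c < p.mstar := fun h h' => p.hℓlt b h c h' hbc.ne
  have hab' := hab.ne
  have hbc' := hbc.ne
  have hac' := hac.ne
  intro h
  rw [h] at hKa hℓa
  rw [← h] at hKb
  simp only [Set.mem_insert_iff, Set.mem_singleton_iff, extK, extℓ] at hKa hℓa hKb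
  clear h
  by_cases ha' : a ∈ p.u
  · by_cases hb' : b ∈ p.u
    · have hc' : c ∉ p.u := fun hc' => hall ⟨ha', hb', hc'⟩
      clear hKa hKb
      have := hKlt b hb'
      have := inj a ha c hc b hb c hc
      have := inj a ha c hc c hc c hc
      grind
    · clear hKa hℓa
      have := hKlt a ha'
      have := hKlt c
      have := inj b hb b hb c hc c hc
      have := inj b hb b hb a ha c hc
      grind
  · clear hKb hℓa
    have := hKlt b
    have := hKlt c
    have := inj a ha a ha b hb b hb
    have := inj a ha a ha c hc c hc
    have := inj a ha a ha b hb c hc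
    grind

lemma linearIndependent_ext (hg : Set.InjOn g u.sym2)
    (hgL : ∀ a ∈ u, ∀ b ∈ u, g s(a, b) < L) :
    LinearIndependent (ZMod 2)
      (Sum.elim (fun a : {a : Omega1 // a ∈ u} => toVec (p.extη g L a))
        (fun q : {q : Omega1 × Omega1 // q.1 ∈ u ∧ q.2 ∈ u ∧ q.1 < q.2} =>
          toVec (p.extρ g L q.1.1 q.1.2))) := by
  classical
  have inj : ∀ v ∈ u, ∀ w ∈ u, ∀ x ∈ u, ∀ y ∈ u, g s(v, w) = g s(x, y) →
      v = x ∧ w = y ∨ v = y ∧ w = x := fun v hv w hw x hx y hy h =>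
    Sym2.eq_iff.1 (hg (by simp [hv, hw]) (by simp [hx, hy]) h)
  have evη : ∀ (a : Omega1) (j : ℕ), j < L →
      toVec (p.extη g L a) (p.n + j) = if j = g s(a, a) then 1 else 0 := fun a j hj => by
    simpa [extη] using toVec_append_unitSeq (p.baseη a) (g s(a, a)) hj
  have evρ : ∀ (a b : Omega1) (j : ℕ), j < L →
      toVec (p.extρ g L a b) (p.n + j) = if j = g s(a, b) then 1 else 0 := fun a b j hj => by
    simpa [extρ] using toVec_append_unitSeq (p.baseρ a b) (g s(a, b)) hj
  let pos : {a : Omega1 // a ∈ u} ⊕ {q : Omega1 × Omega1 // q.1 ∈ u ∧ q.2 ∈ u ∧ q.1 < q.2} → ℕ :=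
    Sum.elim (fun a => p.n + g s(a.1, a.1)) (fun q => p.n + g s(q.1.1, q.1.2))
  refine LinearIndependent.of_comp (LinearMap.funLeft (ZMod 2) (ZMod 2) pos) ?_
  convert Pi.linearIndependent_single_one
    ({a : Omega1 // a ∈ u} ⊕ {q : Omega1 × Omega1 // q.1 ∈ u ∧ q.2 ∈ u ∧ q.1 < q.2}) (ZMod 2)
    using 1
  funext i j
  rw [Pi.single_apply]
  rcases i with ⟨a, ha⟩ | ⟨⟨a, b⟩, ha, hb, hab⟩ <;>
    rcases j with ⟨c, hc⟩ | ⟨⟨c, d⟩, hc, hd, hcd⟩ <;>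
    simp only [Function.comp_apply, LinearMap.funLeft_apply, Sum.elim_inl, Sum.elim_inr, pos]
  · rw [evη a _ (hgL c hc c hc)]
    have := inj c hc c hc a ha a ha
    grind
  · rw [evη a _ (hgL c hc d hd)]
    have := inj c hc d hd a ha a ha
    have := hcd.ne
    grind
  · rw [evρ a b _ (hgL c hc c hc)]
    have := inj c hc c hc a ha b hb
    have := hab.ne
    grind
  · rw [evρ a b _ (hgL c hc d hd)]
    have := inj c hc d hd a ha b hb
    have := lt_asymm hab
    grind

/-- The condition with support `u` obtained from `p` by prolonging all sequences by `L` entries and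
adding `L` trees. -/
noncomputable def extend (p : Cond) (u : Finset Omega1) (hpu : p.u ⊆ u) (g : Sym2 Omega1 → ℕ)
    (hg : Set.InjOn g u.sym2) (L : ℕ) (hgL : ∀ a ∈ u, ∀ b ∈ u, g s(a, b) < L) : Cond where
  u := u
  n := p.n + L
  mstar := p.mstar + L
  η := p.extη g L
  t := p.extTree u g L
  ρ := p.extρ g L
  ℓ := p.extℓ g
  K := p.extK g
  hu := p.hu.mono hpu
  hn := Nat.add_pos_left p.hn L
  hm := Nat.add_pos_left p.hm L
  hη a _ := p.length_extη a
  htree m _ := by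
    refine ⟨?_, ?_, ?_⟩
    · rintro σ ⟨a, _, b, _, _, h⟩
      simpa using h.length_le
    · rintro σ ⟨a, ha, b, hb, hm, h⟩ τ hτ
      exact ⟨a, ha, b, hb, hm, hτ.trans h⟩
    · rintro σ ⟨a, ha, b, hb, hm, h⟩ hσ
      refine ⟨p.extNode g L a b, ⟨a, ha, b, hb, hm, List.prefix_rfl⟩, h, ?_⟩
      rintro rfl
      simp at hσ
  hρlen a _ b _ _ := p.length_extρ a b
  hρsym := p.extρ_comm
  hℓsym := p.extℓ_comm
  hℓlt _ ha _ hb hab := p.extℓ_lt hgL ha hb hab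
  h4 a ha b hb hab := by
    refine ⟨⟨a, ha, b, hb, ?_, ?_⟩, ⟨b, hb, a, ha, ?_, ?_⟩⟩
    · simp [extIndex, hab]
    · simp [extNode, hab]
    · simp [extIndex, hab.symm, p.extℓ_comm b a]
    · simp [extNode, hab.symm, p.extρ_comm b a]
  h5 a ha := ⟨p.extK_lt hgL ha, a, ha, a, ha, by simp [extIndex], by simp [extNode]⟩
  h6 _ ha _ hb _ hc hab hbc := p.ext_triples_ne hg ha hb hc hab hbc
  h7 m m' hm _ σ hσ h h' := by
    obtain ⟨a, ha, b, hb, rfl, rfl⟩ := p.mem_ext_of_length_eq hσ h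
    obtain ⟨c, hc, d, hd, rfl, e⟩ := p.mem_ext_of_length_eq hσ h'
    obtain ⟨rfl, rfl⟩ := p.extNode_injective hg hgL ha hb hc hd e
    exact hm.false
  h8 m _ σ h hσ := by
    obtain ⟨a, ha, b, hb, -, rfl⟩ := p.mem_ext_of_length_eq hσ h
    by_cases hab : a = b
    · exact .inl ⟨a, ha, by simp [extNode, hab]⟩
    · exact .inr ⟨a, ha, b, hb, hab, by simp [extNode, hab]⟩
  h9 := p.linearIndependent_ext hg hgL

lemma take_extNode_self {a : Omega1} (ha : a ∈ p.u) :
    (p.extNode g L a a).take p.n = p.η a := by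
  have := p.length_baseη a
  simp [extNode, extη, ← this, baseη, ha]

lemma take_extNode_of_ne {a b : Omega1} (ha : a ∈ p.u) (hb : b ∈ p.u) (hab : a ≠ b) :
    (p.extNode g L a b).take p.n = addL (p.η a) (p.ρ a b) := by
  rw [extNode, if_neg hab, extη, extρ, addL_append (by simp),
    List.take_left' (by simp)]
  simp [baseη, baseρ, ha, hb, hab]

lemma index_unique {m m' : ℕ} (hm : m < p.mstar) (hm' : m' < p.mstar) {σ : List Bool}
    (hσ : σ.length = p.n) (h : σ ∈ p.t m) (h' : σ ∈ p.t m') : m = m' := by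
  rcases lt_trichotomy m m' with hlt | rfl | hlt
  · exact (p.h7 m m' hlt hm' σ hσ h h').elim
  · rfl
  · exact (p.h7 m' m hlt hm σ hσ h' h).elim

lemma mem_extTree_iff (hpu : p.u ⊆ u) {m : ℕ} (hm : m < p.mstar) {σ : List Bool}
    (hσ : σ.length = p.n) : σ ∈ p.extTree u g L m ↔ σ ∈ p.t m := by
  constructor
  · rintro ⟨a, -, b, -, rfl, h⟩
    rw [List.prefix_iff_eq_take, hσ] at h
    by_cases hab : a = b
    · subst hab
      by_cases ha : a ∈ p.u
      · rw [p.take_extNode_self ha] at h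
        simpa [extIndex, extK, ha, h] using (p.h5 a ha).2
      · simp [extIndex, extK, ha] at hm
    · by_cases ha : a ∈ p.u ∧ b ∈ p.u
      · rw [p.take_extNode_of_ne ha.1 ha.2 hab] at h
        simpa [extIndex, extℓ, ha, hab, h] using (p.h4 a ha.1 b ha.2 hab).1
      · simp [extIndex, extℓ, ha, hab] at hm
  · intro h
    rcases p.h8 m hm σ h hσ with ⟨a, ha, rfl⟩ | ⟨a, ha, b, hb, hab, rfl⟩
    · refine ⟨a, hpu ha, a, hpu ha, ?_, ?_⟩
      · simpa [extIndex, extK, ha] using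
          p.index_unique (p.h5 a ha).1 hm hσ (p.h5 a ha).2 h
      · rw [← p.take_extNode_self (g := g) (L := L) ha]
        exact List.take_prefix _ _
    · refine ⟨a, hpu ha, b, hpu hb, ?_, ?_⟩
      · simpa [extIndex, extℓ, ha, hb, hab] using
          p.index_unique (p.hℓlt a ha b hb hab) hm hσ (p.h4 a ha b hb hab).1 h
      · rw [← p.take_extNode_of_ne (g := g) (L := L) ha hb hab]
        exact List.take_prefix _ _

lemma le_extend (hpu : p.u ⊆ u) (hg : Set.InjOn g u.sym2)
    (hgL : ∀ a ∈ u, ∀ b ∈ u, g s(a, b) < L) : p.Le (p.extend u hpu g hg L hgL) := by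
  refine ⟨hpu, Nat.le_add_right _ _, Nat.le_add_right _ _, fun a ha => ?_,
    fun m hm σ hσ => p.mem_extTree_iff hpu hm hσ, fun a ha => ?_, fun a ha b hb hab => ⟨?_, ?_⟩⟩
  · simpa [extend, extNode] using p.take_extNode_self (g := g) (L := L) ha
  · simp [extend, extK, ha]
  · simp [extend, extℓ, ha, hb]
  · simp [extend, extρ, baseρ, ha, hb, hab]

end Cond

lemma Finset.exists_injOn_nat_lt_card {α : Type*} (s : Finset α) :
    ∃ g : α → ℕ, Set.InjOn g s ∧ ∀ x ∈ s, g x < s.card := by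
  classical
  refine ⟨fun x => if h : x ∈ s then s.equivFin ⟨x, h⟩ else 0, fun x hx y hy h => ?_,
    fun x hx => by simp [hx]⟩
  rw [Finset.mem_coe] at hx hy
  simpa [hx, hy, Fin.val_inj] using h

/-- The set `Z^{N,M}_δ = {p ∈ ℙ : n^p ≥ N ∧ m_*^p ≥ M ∧ δ ∈ u^p}` is open dense in ℙ. -/
theorem stmt8 (N M : ℕ) (δ : Omega1) :
    (∀ p : Cond, ∃ q : Cond, p.Le q ∧ N ≤ q.n ∧ M ≤ q.mstar ∧ δ ∈ q.u) ∧
    (∀ p q : Cond, p.Le q → (N ≤ p.n ∧ M ≤ p.mstar ∧ δ ∈ p.u) →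
      N ≤ q.n ∧ M ≤ q.mstar ∧ δ ∈ q.u) := by
  classical
  refine ⟨fun p => ?_, fun p q h hp => ⟨hp.1.trans h.2.1, hp.2.1.trans h.2.2.1, h.1 hp.2.2⟩⟩
  obtain ⟨g, hg, hcard⟩ := (insert δ p.u).sym2.exists_injOn_nat_lt_card
  have hgL : ∀ a ∈ insert δ p.u, ∀ b ∈ insert δ p.u,
      g s(a, b) < (insert δ p.u).sym2.card + N + M := fun a ha b hb => by
    have := hcard s(a, b) (Finset.mk_mem_sym2_iff.2 ⟨ha, hb⟩)
    omega
  refine ⟨p.extend _ (Finset.subset_insert δ p.u) g hg _ hgL, p.le_extend _ hg hgL, ?_, ?_,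
    Finset.mem_insert_self δ p.u⟩ <;> simp only [Cond.extend] <;> omega
end
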